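/- Let F_q be a finite field of odd order q, let t ∈ F_q with t ≠ 0, and let E ⊆ F_q^2 be nonempty. Define E' = {u ∈ E : #{v ∈ E : ||u−v|| = t} ≥ |E|/(2q)}. Then |E \ E'| ≤ 16 q^3 / |E|. -/

import Mathlib

open Finset

/-- `‖x‖ = x₁² + x₂²` for `x ∈ F_q²`. -/
def nrm {F : Type} [Field F] (x : F × F) : F := x.1 ^ 2 + x.2 ^ 2

section stepanov
open Polynomial

/-- the low-order coefficient argument -/
lemma step_low {K : Type*} [Field K] (r d A : ℕ) (D : K[X]) (hsf : Squarefree D)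
    (hd : D.natDegree ≤ d) (hd1 : 0 < D.natDegree) (c : K) (hc : c ≠ 0) (hA : 2 * A + d < r + 2)
    (u w : K[X]) (hu : u.degree < A) (hw : w.degree < A)
    (h : (X : K[X]) ^ r ∣ u ^ 2 * D - C c * w ^ 2) : u = 0 ∧ w = 0 := by
  have hD0 : D ≠ 0 := hsf.ne_zero
  have key : u ^ 2 * D - C c * w ^ 2 = 0 := by
    apply Polynomial.eq_zero_of_dvd_of_degree_lt h
    rw [degree_X_pow]
    by_cases hA0 : A = 0
    · subst hA0
      have h1 : u = 0 := by
        by_contra h0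
        rw [degree_eq_natDegree h0] at hu
        simp at hu
      have h2 : w = 0 := by
        by_contra h0
        rw [degree_eq_natDegree h0] at hw
        simp at hw
      simp [h1, h2]
    have hun : u.natDegree ≤ A - 1 := by
      by_cases h0 : u = 0
      · simp [h0]
      rw [degree_eq_natDegree h0] at hu
      have : u.natDegree < A := by exact_mod_cast hu
      omega
    have hwn : w.natDegree ≤ A - 1 := by
      by_cases h0 : w = 0
      · simp [h0]
      rw [degree_eq_natDegree h0] at hw
      have : w.natDegree < A := by exact_mod_cast hw
      omega
    have : (u ^ 2 * D - C c * w ^ 2).natDegree ≤ 2 * (A - 1) + d := by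
      refine (natDegree_sub_le _ _).trans (max_le ?_ ?_)
      · refine natDegree_mul_le.trans ?_
        have := natDegree_pow_le (p := u) (n := 2)
        omega
      · refine natDegree_mul_le.trans ?_
        have := natDegree_pow_le (p := w) (n := 2)
        simp only [natDegree_C]
        omega
    refine (degree_le_natDegree).trans_lt ?_
    have h3 : (u ^ 2 * D - C c * w ^ 2).natDegree < r := by omega
    exact_mod_cast h3
  have hw0 : w = 0 := by
    by_contra hw0
    have hu0 : u ≠ 0 := by
      rintro rfl
      simp [hc, hw0] at key
    obtain ⟨π, hπ, hdvd⟩ := exists_irreducible_of_natDegree_pos hd1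
    have hπp : Prime π := hπ.prime
    have e : u ^ 2 * D = C c * w ^ 2 := sub_eq_zero.mp key
    have e1 := congrArg (emultiplicity π) e
    have hCc : emultiplicity π (C c) = 0 := by
      rw [emultiplicity_eq_zero]
      intro hh
      exact hπ.not_isUnit (isUnit_of_dvd_unit hh (isUnit_C.mpr hc.isUnit))
    have hDD : emultiplicity π D = 1 := by
      have h1 : emultiplicity π D ≤ 1 := by
        rcases squarefree_iff_emultiplicity_le_one D |>.mp hsf π with h | h
        · exact h
        · exact absurd h hπ.not_isUnit
      have h2 : 1 ≤ emultiplicity π D := by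
        have := le_emultiplicity_of_pow_dvd (a := π) (b := D) (k := 1) (by simpa using hdvd)
        simpa using this
      exact le_antisymm h1 h2
    rw [emultiplicity_mul hπp, emultiplicity_mul hπp, emultiplicity_pow hπp,
      emultiplicity_pow hπp, hCc, hDD] at e1
    have fu : FiniteMultiplicity π u := FiniteMultiplicity.of_not_isUnit hπ.not_isUnit hu0
    have fw : FiniteMultiplicity π w := FiniteMultiplicity.of_not_isUnit hπ.not_isUnit hw0
    rw [fu.emultiplicity_eq_multiplicity, fw.emultiplicity_eq_multiplicity] at e1
    have : 2 * multiplicity π u + 1 = 0 + 2 * multiplicity π w := by exact_mod_cast e1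
    omega
  refine ⟨?_, hw0⟩
  subst hw0
  simpa [hD0] using key

lemma step_nonvanish {K : Type*} [Field K] (p m : ℕ) [Fact p.Prime] [CharP K p] (r d A J : ℕ)
    (hr : r = p ^ m) (D : K[X]) (hodd : Odd r)
    (hsf : Squarefree D)
    (hd : D.natDegree ≤ d) (hd1 : 0 < D.natDegree) (hD0 : D.eval 0 ≠ 0) (hA : 2 * A + d < r + 2)
    (u w : ℕ → K[X]) (hu : ∀ j, (u j).degree < A) (hw : ∀ j, (w j).degree < A)
    (h : ∑ j ∈ range J, (u j + w j * D ^ ((r - 1) / 2)) * X ^ (r * j) = 0) :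
    ∀ j < J, u j = 0 ∧ w j = 0 := by
  intro j
  induction j using Nat.strong_induction_on with
  | _ j ih =>
  intro hj
  have hr0 : 0 < r := hodd.pos
  set s := D ^ ((r - 1) / 2) with hs
  have hsD : s ^ 2 * D = D ^ r := by
    rw [hs, ← pow_mul, ← pow_succ]
    congr 1
    obtain ⟨k, hk⟩ := hodd
    omega
  -- split
  have h1 : ∃ R : K[X], ∑ j ∈ range J, (u j + w j * s) * X ^ (r * j)
      = X ^ (r * j) * ((u j + w j * s) + X ^ r * R) := by
    have : ∀ i ∈ range J, i ≠ j → X ^ (r * j + r) ∣ (u i + w i * s) * X ^ (r * i) := by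
      intro i hi hij
      rcases lt_or_gt_of_ne hij with hlt | hgt
      · obtain ⟨a, b⟩ := ih i hlt (by simpa using hi)
        simp [a, b]
      · apply Dvd.dvd.mul_left
        apply pow_dvd_pow
        calc r * j + r = r * (j + 1) := by ring
          _ ≤ r * i := Nat.mul_le_mul_left _ hgt
    have h2 : X ^ (r * j + r) ∣ ∑ i ∈ (range J).erase j, (u i + w i * s) * X ^ (r * i) := by
      apply Finset.dvd_sum
      intro i hi
      rw [Finset.mem_erase] at hi
      exact this i hi.2 hi.1
    obtain ⟨R, hR⟩ := h2
    refine ⟨R, ?_⟩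
    rw [← Finset.add_sum_erase _ _ (Finset.mem_range.mpr hj), hR]
    ring
  obtain ⟨R, hR⟩ := h1
  rw [h] at hR
  have h3 : (u j + w j * s) + X ^ r * R = 0 := by
    have := hR.symm
    rcases mul_eq_zero.mp this with h' | h'
    · exact absurd h' (pow_ne_zero _ X_ne_zero)
    · exact h'
  have hDr : X ^ r ∣ D ^ r - C (D.eval 0 ^ r) := by
    have : (X : K[X]) ∣ D - C (D.eval 0) := by
      rw [X_dvd_iff, coeff_sub, coeff_C_zero, coeff_zero_eq_eval_zero, sub_self]
    have h5 := pow_dvd_pow_of_dvd this r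
    rw [hr, sub_pow_char_pow, ← hr, ← C_pow] at h5
    exact h5
  apply step_low r d A D hsf hd hd1 (D.eval 0 ^ r) (pow_ne_zero _ hD0) hA _ _ (hu j) (hw j)
  obtain ⟨S, hS⟩ := hDr
  have hus : u j = - w j * s - X ^ r * R := by linear_combination h3
  have : u j ^ 2 * D - C (D.eval 0 ^ r) * w j ^ 2 =
      X ^ r * (S * w j ^ 2 + 2 * w j * s * R * D + X ^ r * R ^ 2 * D) := by
    rw [hus]
    linear_combination (w j) ^ 2 * hsD + w j ^ 2 * hS
  rw [this]
  exact dvd_mul_right _ _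


lemma step_exists {K : Type*} [Field K] (r d A J : ℕ) (hodd : Odd r)
    (D : K[X]) (hd : D.natDegree ≤ d) (ε : K) (hA0 : 0 < A) (hJ0 : 0 < J)
    (hcnt : r * A + d * ((r - 1) / 2) + J < 2 * A * J) :
    ∃ P W : ℕ → K[X], (∀ j, (P j).degree < A) ∧ (∀ j, (W j).degree < A) ∧
      (∃ j < J, P j ≠ 0 ∨ W j ≠ 0) ∧
      ∑ j ∈ range J, (expand K r (P j) * D ^ ((r - 1) / 2) + C ε * expand K r (W j)) * X ^ j
        = 0 := by
  have hr0 : 0 < r := hodd.pos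
  set s := D ^ ((r - 1) / 2) with hs
  have hsdeg : s.natDegree ≤ d * ((r - 1) / 2) := by
    rw [hs]
    refine natDegree_pow_le.trans ?_
    rw [mul_comm]
    exact Nat.mul_le_mul_right _ hd
  let N := r * A + d * ((r - 1) / 2) + J
  let Φ : (Fin J → (degreeLT K A × degreeLT K A)) →ₗ[K] K[X] :=
    { toFun := fun v => ∑ j : Fin J, (expand K r ((v j).1 : K[X]) * s +
        C ε * expand K r ((v j).2 : K[X])) * X ^ (j : ℕ)
      map_add' := by
        intro v v'
        rw [← Finset.sum_add_distrib]
        refine Finset.sum_congr rfl fun j _ => ?_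
        simp only [Pi.add_apply, Prod.fst_add, Prod.snd_add, Submodule.coe_add, map_add]
        ring
      map_smul' := by
        intro c v
        rw [RingHom.id_apply, Finset.smul_sum]
        refine Finset.sum_congr rfl fun j _ => ?_
        simp only [Pi.smul_apply, Prod.smul_fst, Prod.smul_snd, Submodule.coe_smul, smul_eq_C_mul,
          map_mul, expand_C]
        ring }
  have hdegle : ∀ f : K[X], f ∈ degreeLT K A → f.natDegree ≤ A - 1 := by
    intro f hf
    rw [mem_degreeLT] at hf
    by_cases h0 : f = 0
    · simp [h0]
    rw [degree_eq_natDegree h0] at hf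
    have : f.natDegree < A := by exact_mod_cast hf
    omega
  have hΦ : ∀ v, Φ v ∈ degreeLT K N := by
    intro v
    refine Submodule.sum_mem (degreeLT K N) (t := univ) (f := fun j : Fin J => (expand K r ((v j).1 : K[X]) * s +
        C ε * expand K r ((v j).2 : K[X])) * X ^ (j : ℕ)) ?_
    intro j _
    rw [mem_degreeLT]
    refine degree_le_natDegree.trans_lt ?_
    have h1 := hdegle _ (v j).1.2
    have h2 := hdegle _ (v j).2.2
    have h3 : ∀ f : K[X], f.natDegree ≤ A - 1 → (expand K r f).natDegree + r ≤ r * A := by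
      intro f hf
      rw [natDegree_expand]
      calc f.natDegree * r + r ≤ (A - 1) * r + r := by gcongr
        _ = (A - 1 + 1) * r := by ring
        _ = r * A := by rw [Nat.sub_add_cancel hA0, mul_comm]
    have h4 := h3 _ h1
    have h5 := h3 _ h2
    have h6 : ((expand K r ((v j).1 : K[X]) * s +
        C ε * expand K r ((v j).2 : K[X])) * X ^ (j : ℕ)).natDegree < N := by
      have hj := j.2
      refine lt_of_le_of_lt natDegree_mul_le ?_
      rw [natDegree_X_pow]
      have : (expand K r ((v j).1 : K[X]) * s +
        C ε * expand K r ((v j).2 : K[X])).natDegree ≤ r * A + d * ((r - 1) / 2) := by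
        refine (natDegree_add_le _ _).trans (max_le ?_ ?_)
        · refine natDegree_mul_le.trans ?_
          omega
        · refine natDegree_mul_le.trans ?_
          rw [natDegree_C]
          omega
      show _ < r * A + d * ((r - 1) / 2) + J
      omega
    exact_mod_cast h6
  let Ψ : (Fin J → (degreeLT K A × degreeLT K A)) →ₗ[K] degreeLT K N := Φ.codRestrict _ hΦ
  have hfin : ∀ n, Module.finrank K (degreeLT K n) = n := by
    intro n
    rw [(degreeLTEquiv K n).finrank_eq]
    simp
  have : ∀ n, Module.Finite K (degreeLT K n) := fun n =>
    Module.Finite.equiv (degreeLTEquiv K n).symm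
  have hlt : Module.finrank K (degreeLT K N) < Module.finrank K (Fin J → (degreeLT K A × degreeLT K A)) := by
    rw [hfin]
    show _ < Module.finrank K (Fin J → (degreeLT K A × degreeLT K A))
    rw [Module.finrank_pi_fintype]
    simp only [Module.finrank_prod, hfin, sum_const, card_univ, Fintype.card_fin, smul_eq_mul]
    show r * A + d * ((r - 1) / 2) + J < _
    calc _ < 2 * A * J := hcnt
      _ = _ := by ring
  have hker := LinearMap.ker_ne_bot_of_finrank_lt (f := Ψ) hlt
  obtain ⟨v, hv, hv0⟩ := (Submodule.ne_bot_iff _).mp hker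
  have hv' : Φ v = 0 := by
    have := LinearMap.mem_ker.mp hv
    exact congrArg Subtype.val this
  refine ⟨fun j => if h : j < J then ((v ⟨j, h⟩).1 : K[X]) else 0,
    fun j => if h : j < J then ((v ⟨j, h⟩).2 : K[X]) else 0, ?_, ?_, ?_, ?_⟩
  · intro j
    dsimp only
    split_ifs with h
    · exact mem_degreeLT.mp (v ⟨j, h⟩).1.2
    · simp
  · intro j
    dsimp only
    split_ifs with h
    · exact mem_degreeLT.mp (v ⟨j, h⟩).2.2
    · simp
  · by_contra hcon
    push Not at hcon
    apply hv0
    funext j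
    have := hcon j j.2
    simp only [j.2, dif_pos] at this
    ext1
    · exact Subtype.ext this.1
    · exact Subtype.ext this.2
  · rw [Finset.sum_range]
    rw [← hv']
    refine Finset.sum_congr rfl fun j _ => ?_
    simp [j.2]

lemma step_main {K : Type*} [Field K] [Fintype K] [DecidableEq K] (p m : ℕ) [Fact p.Prime]
    [CharP K p] (r d A J : ℕ)
    (hr : r = p ^ m) (hcard : Fintype.card K = r ^ 2) (D : K[X]) (hodd : Odd r)
    (hsf : Squarefree D)
    (hd : D.natDegree ≤ d) (hd1 : 0 < D.natDegree) (hD0 : D.eval 0 ≠ 0) (hA : 2 * A + d < r + 2)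
    (hA0 : 0 < A) (hJ0 : 0 < J)
    (hcnt : r * A + d * ((r - 1) / 2) + J < 2 * A * J) (ε : K) :
    (univ.filter fun y : K => D.eval y ^ (Fintype.card K / 2) = ε ∧ D.eval y ≠ 0).card
      ≤ A + d * ((r - 1) / 2) + r * J := by
  obtain ⟨P, W, hP, hW, ⟨j0, hj0, hne⟩, hsum⟩ := step_exists r d A J hodd D hd ε hA0 hJ0 hcnt
  have hr0 : 0 < r := hodd.pos
  let φ : K →+* K := iterateFrobenius K p m
  have hφ : ∀ x, φ x = x ^ r := by intro x; rw [hr]; rfl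
  have hφφ : ∀ x, φ (φ x) = x := by
    intro x
    rw [hφ, hφ, ← pow_mul, ← sq, ← hcard, FiniteField.pow_card]
  have hφev : ∀ (f : K[X]) (y : K), ((f.map φ).eval y) ^ r = f.eval (y ^ r) := by
    intro f y
    rw [← hφ, ← hφ y, ← eval₂_hom, ← Polynomial.eval_map, Polynomial.map_map, Polynomial.eval_map]
    have : φ.comp φ = RingHom.id K := RingHom.ext hφφ
    rw [this, hφ, eval₂_id]
  set s := D ^ ((r - 1) / 2) with hs
  let u : ℕ → K[X] := fun j => (P j).map φ
  let w : ℕ → K[X] := fun j => (W j).map φ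
  let G := ∑ j ∈ range J, (u j + w j * s) * X ^ (r * j)
  have hu : ∀ j, (u j).degree < A := fun j => by
    simp only [u, Polynomial.degree_map]; exact hP j
  have hw : ∀ j, (w j).degree < A := fun j => by
    simp only [w, Polynomial.degree_map]; exact hW j
  have hG0 : G ≠ 0 := by
    intro hG
    have := step_nonvanish p m r d A J hr D hodd hsf hd hd1 hD0 hA u w hu hw hG j0 hj0
    simp only [u, w, Polynomial.map_eq_zero] at this
    tauto
  have hdegn : ∀ f : K[X], f.degree < A → f.natDegree ≤ A := by
    intro f hf
    exact natDegree_le_of_degree_le hf.le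
  have hGdeg : G.natDegree ≤ A + d * ((r - 1) / 2) + r * J := by
    apply natDegree_sum_le_of_forall_le
    intro j hj
    refine natDegree_mul_le.trans ?_
    have hsdeg : s.natDegree ≤ d * ((r - 1) / 2) := by
      rw [hs]
      refine natDegree_pow_le.trans ?_
      rw [mul_comm]
      exact Nat.mul_le_mul_right _ hd
    have h1 := hdegn _ (hu j)
    have h2 := hdegn _ (hw j)
    have h3 : (w j * s).natDegree ≤ _ := natDegree_mul_le
    have h4 := natDegree_add_le (u j) (w j * s)
    have h5 : r * j ≤ r * J := Nat.mul_le_mul_left _ (by simp at hj; omega)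
    rw [natDegree_X_pow]
    have h6 : max (u j).natDegree (w j * s).natDegree ≤ A + d * ((r - 1) / 2) :=
      max_le (by omega) (by omega)
    omega
  refine le_trans ?_ hGdeg
  refine le_trans ?_ (Polynomial.card_roots' G)
  refine le_trans ?_ (Multiset.toFinset_card_le _)
  apply Finset.card_le_card
  intro y hy
  rw [Finset.mem_filter] at hy
  obtain ⟨-, hy1, hy2⟩ := hy
  rw [Multiset.mem_toFinset, mem_roots hG0, IsRoot.def]
  have hsy : s.eval y ≠ 0 := by rw [hs, eval_pow]; exact pow_ne_zero _ hy2
  have hsr : (s.eval y) ^ r * s.eval y = ε := by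
    rw [← hy1, hs, eval_pow, ← pow_succ, ← pow_mul]
    congr 1
    rw [hcard]
    obtain ⟨k, hk⟩ := hodd
    subst hk
    have e1 : (2 * k + 1 - 1) / 2 = k := by omega
    have e2 : (2 * k + 1) ^ 2 = 2 * (k * (2 * k + 1 + 1)) + 1 := by ring
    rw [e1, e2]
    omega
  have hyr : (y ^ r) ^ r = y := by rw [← pow_mul, ← sq, ← hcard, FiniteField.pow_card]
  have hz : (G.eval y) ^ r * s.eval y = 0 := by
    rw [← hφ]
    simp only [G, eval_finsetSum, map_sum, Finset.sum_mul]
    have h7 := congrArg (Polynomial.eval y) hsum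
    simp only [eval_finsetSum, eval_zero] at h7
    rw [← h7]
    refine Finset.sum_congr rfl fun j _ => ?_
    simp only [eval_mul, eval_add, eval_pow, eval_X, eval_C, expand_eval, map_mul, map_add, u, w]
    rw [hφ (eval y (Polynomial.map φ (P j))), hφ (eval y (Polynomial.map φ (W j))), hφev, hφev,
      hφ (y ^ _), pow_mul, ← pow_mul, mul_comm j r, pow_mul, hyr, hφ, ← hsr]
    ring
  rcases mul_eq_zero.mp hz with h | h
  · exact pow_eq_zero_iff (by omega) |>.mp h
  · exact absurd h hsy

/-- Stepanov bound for hyperelliptic character sums. -/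
lemma step_bound {K : Type*} [Field K] [Fintype K] [DecidableEq K] (p m : ℕ) [Fact p.Prime]
    [CharP K p] (r d : ℕ) (hd2 : Even d)
    (hr : r = p ^ m) (hcard : Fintype.card K = r ^ 2) (D : K[X]) (hodd : Odd r)
    (hsf : Squarefree D)
    (hd : D.natDegree ≤ d) (hd1 : 0 < D.natDegree) (hD0 : D.eval 0 ≠ 0)
    (hrd : d * (d + 3) ≤ r) :
    |∑ y : K, quadraticChar K (D.eval y)| ≤ (2 * d + 5) * r + d := by
  have hr0 : 0 < r := hodd.pos
  obtain ⟨e, he⟩ := hd2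
  obtain ⟨k, hk⟩ := hodd
  have hchar : ringChar K ≠ 2 := by
    intro h
    have := FiniteField.even_card_of_char_two h
    rw [hcard, hk] at this
    have e2 : (2 * k + 1) ^ 2 = 2 * (k * (2 * k + 1 + 1)) + 1 := by ring
    omega
  have he1 : 0 < e := by omega
  -- A = (r+1-d)/2 = k + 1 - e, J = (r + d + 3)/2 = k + e + 2
  have hke : e * (2 * e + 3) ≤ k := by
    have : (e + e) * (e + e + 3) ≤ 2 * k + 1 := by rw [← he, ← hk]; exact hrd
    nlinarith
  have hek : e ≤ k := le_trans (by nlinarith) hke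
  obtain ⟨A, hA⟩ : ∃ A, A + e = k + 1 := ⟨k + 1 - e, by omega⟩
  have hcnt : r * A + d * ((r - 1) / 2) + (k + e + 2) < 2 * A * (k + e + 2) := by
    have h1 : (r - 1) / 2 = k := by omega
    rw [h1, hk, he]
    have : k = A + e - 1 := by omega
    have h2 : A + e = k + 1 := hA
    zify at *
    have hAe : (A : ℤ) = k + 1 - e := by linarith
    rw [hAe]
    nlinarith
  have hb : ∀ ε : K, ((univ.filter fun y : K =>
      D.eval y ^ (Fintype.card K / 2) = ε ∧ D.eval y ≠ 0).card : ℤ) ≤ A + d * k + r * (k + e + 2) := by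
    intro ε
    have h := step_main p m r d A (k + e + 2) hr hcard D ⟨k, hk⟩ hsf hd hd1 hD0 (by omega) (by omega)
      (by omega) hcnt ε
    have h1 : (r - 1) / 2 = k := by omega
    rw [h1] at h
    exact_mod_cast h
  have hpow := quadraticChar_eq_pow_of_char_ne_two' hchar
  -- sets
  set Sp := univ.filter fun y : K => quadraticChar K (D.eval y) = 1 with hSp
  set Sm := univ.filter fun y : K => quadraticChar K (D.eval y) = -1 with hSm
  set S0 := univ.filter fun y : K => D.eval y = 0 with hS0
  have hp : (Sp.card : ℤ) ≤ A + d * k + r * (k + e + 2) := by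
    refine le_trans ?_ (hb 1)
    have : Sp.card ≤ (univ.filter fun y : K =>
      D.eval y ^ (Fintype.card K / 2) = 1 ∧ D.eval y ≠ 0).card := by
      apply Finset.card_le_card
      intro y hy
      simp only [hSp, mem_filter, mem_univ, true_and] at hy ⊢
      refine ⟨?_, ?_⟩
      · rw [← hpow, hy]; simp
      · intro h0
        rw [h0] at hy
        simp at hy
    exact_mod_cast this
  have hm : (Sm.card : ℤ) ≤ A + d * k + r * (k + e + 2) := by
    refine le_trans ?_ (hb (-1))
    have : Sm.card ≤ (univ.filter fun y : K =>
      D.eval y ^ (Fintype.card K / 2) = -1 ∧ D.eval y ≠ 0).card := by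
      apply Finset.card_le_card
      intro y hy
      simp only [hSm, mem_filter, mem_univ, true_and] at hy ⊢
      refine ⟨?_, ?_⟩
      · rw [← hpow, hy]; simp
      · intro h0
        rw [h0] at hy
        simp at hy
    exact_mod_cast this
  have h0 : (S0.card : ℤ) ≤ d := by
    have : S0.card ≤ d := by
      refine le_trans ?_ hd
      refine le_trans ?_ (Polynomial.card_roots' D)
      refine le_trans ?_ (Multiset.toFinset_card_le _)
      apply Finset.card_le_card
      intro y hy
      simp only [hS0, mem_filter, mem_univ, true_and] at hy
      rw [Multiset.mem_toFinset, mem_roots hsf.ne_zero]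
      exact hy
    exact_mod_cast this
  have hterm : ∀ y : K, quadraticChar K (D.eval y) =
      (if quadraticChar K (D.eval y) = 1 then 1 else 0) -
      (if quadraticChar K (D.eval y) = -1 then (1 : ℤ) else 0) ∧
      (1 : ℤ) = (if quadraticChar K (D.eval y) = 1 then 1 else 0) +
      (if quadraticChar K (D.eval y) = -1 then (1 : ℤ) else 0) +
      (if D.eval y = 0 then 1 else 0) := by
    intro y
    by_cases h : D.eval y = 0
    · simp [h]
    · rcases quadraticChar_dichotomy h with h' | h' <;> simp [h, h']
  have hs1 : ∑ y : K, quadraticChar K (D.eval y) = (Sp.card : ℤ) - Sm.card := by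
    rw [Finset.sum_congr rfl fun y _ => (hterm y).1, Finset.sum_sub_distrib]
    simp [hSp, hSm, Finset.sum_boole]
  have hs2 : (r : ℤ) ^ 2 = (Sp.card : ℤ) + Sm.card + S0.card := by
    have : ∑ y : K, (1 : ℤ) = (r : ℤ) ^ 2 := by
      simp [hcard]
    rw [← this, Finset.sum_congr rfl fun y _ => (hterm y).2, Finset.sum_add_distrib,
      Finset.sum_add_distrib]
    simp [hSp, hSm, hS0, Finset.sum_boole]
  rw [hs1]
  have hrk : (r : ℤ) = 2 * k + 1 := by exact_mod_cast hk
  have hde : (d : ℤ) = e + e := by exact_mod_cast he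
  have hAk : (A : ℤ) + e = k + 1 := by exact_mod_cast hA
  have hk0 : (0 : ℤ) ≤ k := by positivity
  have he0 : (0 : ℤ) < e := by exact_mod_cast he1
  have hAA : (A : ℤ) = k + 1 - e := by linarith
  rw [abs_le]
  rw [hrk, hde] at *
  rw [hAA] at hp hm
  constructor <;> nlinarith

end stepanov


section klext
open Polynomial

lemma kl_sum_eq {K : Type*} [Field K] [Fintype K] [DecidableEq K] (hchar : ringChar K ≠ 2)
    (χ : AddChar K ℂ) (hχ : χ ≠ 1) (a : K) (ha : a ≠ 0) :
    ∑ x : K, (if x = 0 then (0 : ℂ) else χ (x + a * x⁻¹)) =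
      ∑ z : K, χ z * ((quadraticChar K (z ^ 2 - 4 * a) : ℤ) : ℂ) := by
  have h2 : (2 : K) ≠ 0 := Ring.two_ne_zero hchar
  have h1 : ∑ x : K, (if x = 0 then (0 : ℂ) else χ (x + a * x⁻¹)) =
      ∑ x : K, ∑ z : K, if x ^ 2 - z * x + a = 0 then χ z else 0 := by
    refine Finset.sum_congr rfl fun x _ => ?_
    split_ifs with hx
    · subst hx
      simp [ha]
    · have : ∀ z, (x ^ 2 - z * x + a = 0) ↔ (x + a * x⁻¹ = z) := by
        intro z
        constructor
        · intro h
          field_simp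
          linear_combination h
        · rintro rfl
          field_simp
          ring
      simp only [this, Finset.sum_ite_eq, Finset.mem_univ, if_true]
  rw [h1, Finset.sum_comm]
  have h3 : ∀ z : K, ∑ x : K, (if x ^ 2 - z * x + a = 0 then χ z else 0) =
      χ z * ((quadraticChar K (z ^ 2 - 4 * a) : ℤ) : ℂ) + χ z := by
    intro z
    rw [← Finset.sum_filter, Finset.sum_const, nsmul_eq_mul]
    have h4 := quadraticChar_card_sqrts hchar (z ^ 2 - 4 * a)
    have h5 : (univ.filter fun x : K => x ^ 2 - z * x + a = 0).card =
        ({x : K | x ^ 2 = z ^ 2 - 4 * a}.toFinset).card := by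
      refine Finset.card_bij (fun x _ => 2 * x - z) ?_ ?_ ?_
      · intro x hx
        simp only [mem_filter, mem_univ, true_and, Set.mem_toFinset, Set.mem_ofPred_eq] at hx ⊢
        linear_combination 4 * hx
      · intro x _ y _ h
        have : 2 * (x - y) = 0 := by linear_combination h
        rcases mul_eq_zero.mp this with h | h
        · exact absurd h h2
        · exact sub_eq_zero.mp h
      · intro w hw
        simp only [mem_filter, mem_univ, true_and, Set.mem_toFinset, Set.mem_ofPred_eq] at hw ⊢
        refine ⟨(w + z) / 2, ?_, ?_⟩
        · field_simp
          linear_combination hw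
        · field_simp
          ring
    rw [h5]
    have h6 : (({x : K | x ^ 2 = z ^ 2 - 4 * a}.toFinset.card : ℤ) : ℂ) =
      ((quadraticChar K (z ^ 2 - 4 * a) + 1 : ℤ) : ℂ) := by rw [h4]
    push_cast at h6
    rw [h6]
    ring
  rw [Finset.sum_congr rfl fun z _ => h3 z, Finset.sum_add_distrib,
    AddChar.sum_eq_zero_of_ne_one hχ, add_zero]

lemma kl_ext_bound {k K : Type*} [Field k] [Fintype k] [Field K] [Fintype K] [DecidableEq K]
    [Algebra k K] (hq : Odd (Fintype.card k)) (m : ℕ)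
    (hcard : Fintype.card K = Fintype.card k ^ (2 * m))
    (ψ : AddChar k ℂ) (hψ : ψ ≠ 1) (a : k) (ha : a ≠ 0)
    (hm : (2 * Fintype.card k) * (2 * Fintype.card k + 3) ≤ Fintype.card k ^ m) :
    ‖∑ x : K, (if x = 0 then (0 : ℂ) else
      ψ (Algebra.trace k K (x + algebraMap k K a * x⁻¹)))‖ ≤
      (6 * Fintype.card k + 7 : ℝ) * (Fintype.card k : ℝ) ^ m := by
  classical
  set q := Fintype.card k with hqdef
  obtain ⟨p, hpk, n, hp, hpn⟩ := FiniteField.card' k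
  have hp' := Fact.mk hp
  have hpK : CharP K p := (Algebra.charP_iff k K p).mp hpk
  set r := q ^ m with hrdef
  have hr : r = p ^ ((n : ℕ) * m) := by rw [hrdef, hqdef, hpn, pow_mul]
  have hrodd : Odd r := hq.pow
  have hcard2 : Fintype.card K = r ^ 2 := by rw [hcard, hrdef, ← pow_mul, mul_comm]
  have hq1 : 1 < q := Fintype.one_lt_card
  have hchar : ringChar K ≠ 2 := by
    intro h
    have h1 := FiniteField.even_card_of_char_two h
    have h2 : Odd (Fintype.card K) := by rw [hcard2]; exact hrodd.pow
    rw [Nat.odd_iff] at h2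
    omega
  have h2K : (2 : K) ≠ 0 := Ring.two_ne_zero hchar
  set a' := algebraMap k K a with ha'def
  have ha' : a' ≠ 0 := by
    rw [ha'def]; simpa using ha
  let χ : AddChar K ℂ := ψ.compAddMonoidHom (Algebra.trace k K).toAddMonoidHom
  have hχapp : ∀ x, χ x = ψ (Algebra.trace k K x) := fun x => rfl
  have hχ1 : χ ≠ 1 := by
    intro h
    apply hψ
    ext c
    obtain ⟨x, hx⟩ := Algebra.trace_surjective k K c
    have := DFunLike.congr_fun h x
    rw [hχapp, hx] at this
    rw [this]
    simp
  have hfrob : ∀ y : K, χ (y ^ q - y) = 1 := by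
    intro y
    have : Algebra.trace k K (y ^ q) = Algebra.trace k K y := by
      have h := Algebra.trace_eq_of_algEquiv (FiniteField.frobeniusAlgEquivOfAlgebraic k K) y
      rw [FiniteField.coe_frobeniusAlgEquivOfAlgebraic] at h
      exact h
    rw [hχapp, map_sub, this, sub_self, AddChar.map_zero_eq_one]
  have e1 : ∑ x : K, (if x = 0 then (0 : ℂ) else
      ψ (Algebra.trace k K (x + a' * x⁻¹))) =
      ∑ z : K, χ z * ((quadraticChar K (z ^ 2 - 4 * a') : ℤ) : ℂ) :=
    kl_sum_eq hchar χ hχ1 a' ha'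
  rw [e1]
  set S := ∑ z : K, χ z * ((quadraticChar K (z ^ 2 - 4 * a') : ℤ) : ℂ) with hS
  let D : K → K[X] := fun b => (X ^ q - X + C b) ^ 2 - C (4 * a')
  have hDev : ∀ b y, (D b).eval y = (y ^ q - y + b) ^ 2 - 4 * a' := by
    intro b y
    simp [D]
  have hQS : ((r : ℂ) ^ 2) * S =
      ∑ b : K, χ b * ((∑ y : K, quadraticChar K ((D b).eval y) : ℤ) : ℂ) := by
    have h3 : ∀ y : K, S = ∑ b : K, χ b * ((quadraticChar K ((D b).eval y) : ℤ) : ℂ) := by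
      intro y
      rw [hS, ← Equiv.sum_comp (Equiv.addLeft (y ^ q - y))]
      refine Finset.sum_congr rfl fun b _ => ?_
      rw [Equiv.coe_addLeft, hDev, AddChar.map_add_eq_mul, hfrob, one_mul]
    have h4 : ((r : ℂ) ^ 2) * S = ∑ y : K, S := by
      rw [Finset.sum_const, nsmul_eq_mul, Finset.card_univ, hcard2]
      push_cast
      rfl
    rw [h4, Finset.sum_congr rfl fun y _ => h3 y, Finset.sum_comm]
    refine Finset.sum_congr rfl fun b _ => ?_
    push_cast
    rw [Finset.mul_sum]
  have hqK : ((q : ℕ) : K) = 0 := by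
    have : (p : K) = 0 := CharP.cast_eq_zero K p
    rw [hqdef, hpn]
    push_cast
    rw [this, zero_pow n.pos.ne']
  have hdegT : ∀ b : K, (X ^ q - X + C b : K[X]).natDegree = q := by
    intro b
    have h1 : (X - C b : K[X]).degree < (X ^ q : K[X]).degree := by
      rw [degree_X_sub_C, degree_X_pow]
      exact_mod_cast hq1
    have h2 : (X ^ q - X + C b : K[X]) = X ^ q - (X - C b) := by ring
    rw [h2, natDegree_eq_of_degree_eq (degree_sub_eq_left_of_degree_lt h1), natDegree_X_pow]
  have hdegD : ∀ b : K, (D b).natDegree = 2 * q := by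
    intro b
    simp only [D]
    rw [natDegree_sub_C, natDegree_pow, hdegT]
  have hsf : ∀ b : K, Squarefree (D b) := by
    intro b
    apply Polynomial.Separable.squarefree
    rw [separable_def]
    have hder : derivative (D b) = -2 * (X ^ q - X + C b) := by
      simp only [D]
      rw [derivative_sub, derivative_C, derivative_pow, derivative_add, derivative_C,
        derivative_sub, derivative_X_pow, derivative_X, hqK]
      have hC2 : (C (2 : K)) = (2 : K[X]) := map_ofNat C 2
      simp [hC2]
    rw [hder]
    have hu : C ((-(4 * a'))⁻¹) * C (-(4 * a')) = (1 : K[X]) := by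
      rw [← C_mul, inv_mul_cancel₀, C_1]
      rw [neg_ne_zero]
      refine mul_ne_zero ?_ ha'
      have : (4 : K) = 2 * 2 := by norm_num
      rw [this]
      exact mul_ne_zero h2K h2K
    have h2C : C ((2 : K)⁻¹) * 2 = (1 : K[X]) := by
      have : (2 : K[X]) = C 2 := (map_ofNat C 2).symm
      rw [this, ← C_mul, inv_mul_cancel₀ h2K, C_1]
    refine ⟨C ((-(4 * a'))⁻¹), C ((-(4 * a'))⁻¹) * C (2⁻¹) * (X ^ q - X + C b), ?_⟩
    simp only [D]
    rw [← hu, C_neg (a := 4 * a')]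
    linear_combination (- C ((-(4 * a'))⁻¹) * (X ^ q - X + C b) ^ 2) * h2C
  have hgood : ∀ b : K, b ^ 2 - 4 * a' ≠ 0 →
      |∑ y : K, quadraticChar K ((D b).eval y)| ≤ (2 * (2 * q : ℕ) + 5) * r + (2 * q : ℕ) := by
    intro b hb
    refine step_bound p ((n : ℕ) * m) r (2 * q) (even_two_mul q) hr hcard2 (D b) hrodd (hsf b)
      (hdegD b).le (by rw [hdegD]; omega) ?_ hm
    rw [hDev]
    rw [zero_pow (by omega)]
    simpa using hb
  have hbad : ∀ b : K, |∑ y : K, quadraticChar K ((D b).eval y)| ≤ (r : ℤ) ^ 2 := by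
    intro b
    refine (Finset.abs_sum_le_sum_abs _ _).trans ?_
    have : ∀ z : K, |quadraticChar K z| ≤ 1 := by
      intro z
      by_cases h : z = 0
      · simp [h]
      · rcases quadraticChar_dichotomy h with h | h <;> simp [h]
    refine (Finset.sum_le_sum fun y _ => this _).trans ?_
    simp [hcard2]
  have hall : ∀ b : K, ‖χ b * ((∑ y : K, quadraticChar K ((D b).eval y) : ℤ) : ℂ)‖ ≤
      ((4 * q + 5) * r + 2 * q : ℝ) + if b ^ 2 = 4 * a' then (r : ℝ) ^ 2 else 0 := by
    intro b
    rw [norm_mul, AddChar.norm_apply, one_mul, Complex.norm_intCast]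
    split_ifs with h
    · have h1 : ((|∑ y : K, quadraticChar K ((D b).eval y)| : ℤ) : ℝ) ≤ ((r : ℤ) ^ 2 : ℤ) :=
        Int.cast_le.mpr (hbad b)
      rw [Int.cast_abs] at h1
      refine h1.trans ?_
      push_cast
      have : (0 : ℝ) ≤ ((4 * q + 5) * r + 2 * q : ℝ) := by positivity
      linarith
    · have h1 : ((|∑ y : K, quadraticChar K ((D b).eval y)| : ℤ) : ℝ) ≤
          ((2 * (2 * q : ℕ) + 5) * r + (2 * q : ℕ) : ℤ) :=
        Int.cast_le.mpr (hgood b (sub_ne_zero.mpr h))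
      rw [Int.cast_abs] at h1
      refine h1.trans (le_of_eq ?_)
      push_cast
      ring
  have hcnt2 : ((univ.filter fun b : K => b ^ 2 = 4 * a').card : ℝ) ≤ 2 := by
    have h4 := quadraticChar_card_sqrts hchar (4 * a')
    have h5 : quadraticChar K (4 * a') ≤ 1 := by
      by_cases h : (4 * a') = 0
      · simp [h]
      · rcases quadraticChar_dichotomy h with h | h <;> simp [h]
    have h6 : (univ.filter fun b : K => b ^ 2 = 4 * a') =
        ({x : K | x ^ 2 = 4 * a'}.toFinset) := by
      ext x; simp
    rw [h6]
    have : ({x : K | x ^ 2 = 4 * a'}.toFinset).card ≤ 2 := by omega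
    exact_mod_cast this
  have hr1 : (1 : ℝ) ≤ r := by exact_mod_cast hrodd.pos
  have hfinal : (r : ℝ) ^ 2 * ‖S‖ ≤ (r : ℝ) ^ 2 * (((4 * q + 5) * r + 2 * q : ℝ) + 2) := by
    have h1 : (r : ℝ) ^ 2 * ‖S‖ = ‖((r : ℂ) ^ 2) * S‖ := by
      rw [norm_mul, norm_pow, Complex.norm_natCast]
    rw [h1, hQS]
    refine (norm_sum_le _ _).trans ?_
    refine (Finset.sum_le_sum fun b _ => hall b).trans ?_
    rw [Finset.sum_add_distrib, Finset.sum_const, nsmul_eq_mul, Finset.card_univ, hcard2,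
      ← Finset.sum_filter, Finset.sum_const, nsmul_eq_mul]
    push_cast
    have : (0 : ℝ) ≤ (r : ℝ) ^ 2 := by positivity
    nlinarith
  have h8 := le_of_mul_le_mul_left hfinal (by positivity)
  refine h8.trans ?_
  have hr2 : ((q : ℝ)) ^ m = r := by rw [hrdef]; push_cast; rfl
  rw [hr2]
  have : (0 : ℝ) ≤ q := by positivity
  nlinarith

end klext


section lfun
open Polynomial

/-- multiplicative function attached to the Kloosterman sum -/
noncomputable def Lam {k : Type*} [Field k] [DecidableEq k] (ψ : AddChar k ℂ) (a : k) (g : k[X]) : ℂ :=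
  if g.coeff 0 = 0 then 0 else ψ (-(g.nextCoeff) - a * (g.coeff 1 / g.coeff 0))

lemma Lam_one {k : Type*} [Field k] [DecidableEq k] (ψ : AddChar k ℂ) (a : k) :
    Lam ψ a 1 = 1 := by
  have h : (1 : k[X]).nextCoeff = 0 := by
    rw [← C_1, nextCoeff_C_eq_zero]
  simp [Lam, h, coeff_one]

lemma Lam_mul {k : Type*} [Field k] [DecidableEq k] (ψ : AddChar k ℂ) (a : k) (g h : k[X])
    (hg : g.Monic) (hh : h.Monic) : Lam ψ a (g * h) = Lam ψ a g * Lam ψ a h := by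
  unfold Lam
  rw [mul_coeff_zero, mul_coeff_one, hg.nextCoeff_mul hh]
  by_cases h1 : g.coeff 0 = 0
  · simp [h1]
  by_cases h2 : h.coeff 0 = 0
  · simp [h2]
  rw [if_neg h1, if_neg h2, if_neg (mul_ne_zero h1 h2), ← AddChar.map_add_eq_mul]
  congr 1
  field_simp
  ring

lemma Lam_pow {k : Type*} [Field k] [DecidableEq k] (ψ : AddChar k ℂ) (a : k) (g : k[X])
    (hg : g.Monic) (j : ℕ) : Lam ψ a (g ^ j) = Lam ψ a g ^ j := by
  induction j with
  | zero => simp [Lam_one]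
  | succ j ih => rw [pow_succ, Lam_mul ψ a _ _ (hg.pow j) hg, ih, pow_succ]

lemma mon_finite (k : Type*) [Field k] [Finite k] (n : ℕ) :
    {g : k[X] | g.Monic ∧ g.natDegree = n}.Finite := by
  apply Set.Finite.of_finite_image (f := fun g : k[X] => fun i : Fin (n + 1) => g.coeff i)
    (Set.toFinite _)
  rintro g ⟨_, hg⟩ h ⟨_, hh⟩ e
  ext i
  by_cases hi : i < n + 1
  · exact congrFun e ⟨i, hi⟩
  · rw [coeff_eq_zero_of_natDegree_lt (by omega), coeff_eq_zero_of_natDegree_lt (by omega)]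

/-- monic polynomials of degree n -/
noncomputable def mon (k : Type*) [Field k] [Finite k] (n : ℕ) : Finset k[X] :=
  (mon_finite k n).toFinset

lemma mem_mon {k : Type*} [Field k] [Finite k] {n : ℕ} {g : k[X]} :
    g ∈ mon k n ↔ g.Monic ∧ g.natDegree = n := by
  simp [mon]

/-- L-function coefficients -/
noncomputable def Sco {k : Type*} [Field k] [Finite k] [DecidableEq k] (ψ : AddChar k ℂ) (a : k)
    (n : ℕ) : ℂ := ∑ g ∈ mon k n, Lam ψ a g

lemma Sco_zero {k : Type*} [Field k] [Finite k] [DecidableEq k] (ψ : AddChar k ℂ) (a : k) :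
    Sco ψ a 0 = 1 := by
  have : mon k 0 = {1} := by
    ext g
    rw [mem_mon, Finset.mem_singleton]
    constructor
    · rintro ⟨h1, h2⟩
      have h3 := eq_C_of_natDegree_eq_zero h2
      have h4 : g.coeff 0 = 1 := by rw [← h2]; exact h1
      rw [h3, h4, C_1]
    · rintro rfl
      simp
  rw [Sco, this, Finset.sum_singleton, Lam_one]

lemma Sco_one {k : Type*} [Field k] [Fintype k] [DecidableEq k] (ψ : AddChar k ℂ) (a : k) :
    Sco ψ a 1 = ∑ x : k, if x = 0 then (0 : ℂ) else ψ (x + a * x⁻¹) := by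
  symm
  refine Finset.sum_bij (fun x _ => X - C x) ?_ ?_ ?_ ?_
  · intro x _
    rw [mem_mon]
    exact ⟨monic_X_sub_C x, natDegree_X_sub_C x⟩
  · intro x _ y _ h
    have := congrArg (fun g => coeff g 0) h
    simpa using this
  · intro g hg
    rw [mem_mon] at hg
    refine ⟨-g.coeff 0, Finset.mem_univ _, ?_⟩
    have := hg.1.eq_X_add_C hg.2
    rw [C_neg, sub_neg_eq_add]
    exact this.symm
  · intro x _
    unfold Lam
    have h1 : (X - C x : k[X]).coeff 0 = -x := by simp
    have h2 : (X - C x : k[X]).coeff 1 = 1 := by simp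
    rw [nextCoeff_X_sub_C, h1, h2]
    by_cases hx : x = 0
    · simp [hx]
    · rw [if_neg hx, if_neg (neg_ne_zero.mpr hx)]
      congr 1
      field_simp
      ring

lemma Sco_two {k : Type*} [Field k] [Fintype k] [DecidableEq k] (ψ : AddChar k ℂ) (hψ : ψ ≠ 1)
    (a : k) (ha : a ≠ 0) : Sco ψ a 2 = Fintype.card k := by
  have h1 : Sco ψ a 2 = ∑ c0 : k, ∑ c1 : k,
      if c0 = 0 then (0 : ℂ) else ψ (-c1 - a * (c1 / c0)) := by
    symm
    rw [← Finset.sum_product']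
    refine Finset.sum_bij (fun x _ => X ^ 2 + (C x.2 * X + C x.1)) ?_ ?_ ?_ ?_
    · intro x _
      rw [mem_mon]
      have hlt : (C x.2 * X + C x.1 : k[X]).degree < 2 :=
        lt_of_le_of_lt degree_linear_le (by norm_num)
      refine ⟨monic_X_pow_add hlt, ?_⟩
      have := degree_add_eq_left_of_degree_lt (p := (X ^ 2 : k[X]))
        (q := C x.2 * X + C x.1) (by rw [degree_X_pow]; exact hlt)
      rw [natDegree_eq_of_degree_eq this, natDegree_X_pow]
    · intro x _ y _ h
      have e0 := congrArg (fun g => coeff g 0) h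
      have e1 := congrArg (fun g => coeff g 1) h
      simp [coeff_X_pow, coeff_C] at e0 e1
      exact Prod.ext e0 e1
    · intro g hg
      rw [mem_mon] at hg
      refine ⟨(g.coeff 0, g.coeff 1), Finset.mem_univ _, ?_⟩
      have h3 := hg.1.as_sum
      rw [hg.2] at h3
      rw [h3, Finset.sum_range_succ, Finset.sum_range_one]
      simp [coeff_X_pow, coeff_C]
      ring
    · intro x _
      have hlt : (C x.2 * X + C x.1 : k[X]).degree < 2 :=
        lt_of_le_of_lt degree_linear_le (by norm_num)
      have hnd : (X ^ 2 + (C x.2 * X + C x.1) : k[X]).natDegree = 2 := by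
        have := degree_add_eq_left_of_degree_lt (p := (X ^ 2 : k[X]))
          (q := C x.2 * X + C x.1) (by rw [degree_X_pow]; exact hlt)
        rw [natDegree_eq_of_degree_eq this, natDegree_X_pow]
      have hnc : (X ^ 2 + (C x.2 * X + C x.1) : k[X]).nextCoeff = x.2 := by
        rw [nextCoeff_of_natDegree_pos (by omega), hnd]
        simp [coeff_X_pow, coeff_C]
      have hc0 : (X ^ 2 + (C x.2 * X + C x.1) : k[X]).coeff 0 = x.1 := by
        simp
      have hc1 : (X ^ 2 + (C x.2 * X + C x.1) : k[X]).coeff 1 = x.2 := by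
        simp [coeff_X_pow, coeff_C]
      unfold Lam
      rw [hnc, hc0, hc1]
  rw [h1, Finset.sum_eq_single (-a)]
  · have : ∀ c1 : k, -c1 - a * (c1 / -a) = 0 := by
      intro c1; field_simp; ring
    simp [this, ha]
  · intro c0 _ hc0
    by_cases h0 : c0 = 0
    · simp [h0]
    simp only [h0, if_false]
    have : ∀ c1 : k, -c1 - a * (c1 / c0) = (-(1 + a / c0)) * c1 := by
      intro c1; field_simp; ring
    simp only [this]
    have hne : -(1 + a / c0) ≠ 0 := by
      intro h
      apply hc0
      field_simp at h
      linear_combination - h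
    have := AddChar.sum_mulShift (-(1 + a / c0)) (AddChar.IsPrimitive.of_ne_one hψ)
    rw [if_neg hne] at this
    rw [← Nat.cast_zero (R := ℂ), ← this]
    exact Finset.sum_congr rfl fun c _ => by rw [mul_comm]
  · simp

lemma Sco_big {k : Type*} [Field k] [Fintype k] [DecidableEq k] (ψ : AddChar k ℂ) (hψ : ψ ≠ 1)
    (a : k) (n : ℕ) (hn : 3 ≤ n) : Sco ψ a n = 0 := by
  obtain ⟨b, hb⟩ : ∃ b, ψ b ≠ 1 := by
    by_contra h
    push Not at h
    exact hψ (DFunLike.ext _ _ h)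
  have hmem : ∀ (b : k) (g : k[X]), g ∈ mon k n → g - C b * X ^ (n - 1) ∈ mon k n := by
    intro b g hg
    rw [mem_mon] at hg ⊢
    have hdeg : (C b * X ^ (n - 1) : k[X]).degree < g.degree := by
      refine (degree_C_mul_X_pow_le _ _).trans_lt ?_
      rw [degree_eq_natDegree hg.1.ne_zero, hg.2]
      have : n - 1 < n := by omega
      exact_mod_cast this
    refine ⟨hg.1.sub_of_left hdeg, ?_⟩
    rw [natDegree_eq_of_degree_eq (degree_sub_eq_left_of_degree_lt hdeg), hg.2]
  have key : Sco ψ a n = ψ b * Sco ψ a n := by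
    conv_rhs => rw [Sco, Finset.mul_sum]
    rw [Sco]
    symm
    refine Finset.sum_bij (fun g _ => g - C b * X ^ (n - 1)) (fun g hg => hmem b g hg) ?_ ?_ ?_
    · intro g _ h _ e
      simpa using e
    · intro g hg
      refine ⟨g - C (-b) * X ^ (n - 1), hmem _ _ hg, ?_⟩
      simp
    · intro g hg
      have hg' := hmem b g hg
      rw [mem_mon] at hg hg'
      have c0 : (g - C b * X ^ (n - 1)).coeff 0 = g.coeff 0 := by
        rw [coeff_sub, coeff_C_mul_X_pow, if_neg (by omega), sub_zero]
      have c1 : (g - C b * X ^ (n - 1)).coeff 1 = g.coeff 1 := by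
        rw [coeff_sub, coeff_C_mul_X_pow, if_neg (by omega), sub_zero]
      have c2 : (g - C b * X ^ (n - 1)).nextCoeff = g.nextCoeff - b := by
        rw [nextCoeff_of_natDegree_pos (by omega), nextCoeff_of_natDegree_pos (by omega), hg.2,
          hg'.2, coeff_sub, coeff_C_mul_X_pow, if_pos rfl]
      unfold Lam
      rw [c0, c1, c2]
      split_ifs
      · simp
      · rw [← AddChar.map_add_eq_mul]
        congr 1
        ring
  have : (1 - ψ b) * Sco ψ a n = 0 := by linear_combination key
  rcases mul_eq_zero.mp this with h | h
  · exact absurd (sub_eq_zero.mp h).symm hb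
  · exact h

/-- monic irreducibles of degree at most n -/
noncomputable def Irr (k : Type*) [Field k] [Finite k] (n : ℕ) : Finset k[X] := by
  classical
  exact ((range (n + 1)).biUnion fun d => mon k d).filter Irreducible

lemma mem_Irr {k : Type*} [Field k] [Finite k] {n : ℕ} {P : k[X]} :
    P ∈ Irr k n ↔ P.Monic ∧ P.natDegree ≤ n ∧ Irreducible P := by
  classical
  simp only [Irr, mem_filter, mem_biUnion, mem_mon, mem_range]
  constructor
  · rintro ⟨⟨d, h1, h2, h3⟩, h4⟩
    exact ⟨h2, by omega, h4⟩
  · rintro ⟨h1, h2, h3⟩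
    exact ⟨⟨_, by omega, h1, rfl⟩, h3⟩

/-- power sums -/
noncomputable def kap {k : Type*} [Field k] [Finite k] [DecidableEq k] (ψ : AddChar k ℂ) (a : k)
    (m : ℕ) : ℂ := ∑ P ∈ (Irr k m).filter (fun P => P.natDegree ∣ m),
      (P.natDegree : ℂ) * Lam ψ a P ^ (m / P.natDegree)

lemma deg_count {k : Type*} [Field k] [Finite k] (n : ℕ) (g : k[X]) (hg : g ∈ mon k n) :
    (n : ℕ) = ∑ P ∈ Irr k n, ∑ j ∈ Icc 1 n, by
      classical exact if P ^ j ∣ g then P.natDegree else 0 := by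
  classical
  open UniqueFactorizationMonoid in
  rw [mem_mon] at hg
  obtain ⟨hm, hd⟩ := hg
  have hg0 := hm.ne_zero
  have hmonic : ∀ P ∈ normalizedFactors g, P.Monic := by
    intro P hP
    have h1 := normalize_normalized_factor P hP
    rw [← h1]
    exact monic_normalize (irreducible_of_normalized_factor P hP).ne_zero
  have hprod : (normalizedFactors g).prod = g := by
    have h1 := prod_normalizedFactors hg0
    refine eq_of_monic_of_associated ?_ hm h1
    have := monic_multiset_prod_of_monic (normalizedFactors g) id (by simpa using hmonic)
    simpa using this
  have hdeg : n = ((normalizedFactors g).map natDegree).sum := by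
    rw [← hd]
    conv_lhs => rw [← hprod]
    exact natDegree_multiset_prod_of_monic _ hmonic
  have hsub : (normalizedFactors g).toFinset ⊆ Irr k n := by
    intro P hP
    rw [Multiset.mem_toFinset] at hP
    rw [mem_Irr]
    refine ⟨hmonic P hP, ?_, irreducible_of_normalized_factor P hP⟩
    rw [← hd]
    exact natDegree_le_of_dvd (dvd_of_mem_normalizedFactors hP) hg0
  rw [Finset.sum_multiset_map_count] at hdeg
  refine hdeg.trans ?_
  rw [Finset.sum_subset hsub]
  · refine Finset.sum_congr rfl fun P hP => ?_
    rw [mem_Irr] at hP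
    rw [← Finset.sum_filter, Finset.sum_const]
    congr 1
    have hc : ∀ j, P ^ j ∣ g ↔ j ≤ (normalizedFactors g).count P := by
      intro j
      have h1 := emultiplicity_eq_count_normalizedFactors hP.2.2 hg0
      rw [hP.1.normalize_eq_self] at h1
      rw [← Nat.cast_le (α := ℕ∞), ← h1, pow_dvd_iff_le_emultiplicity]
    have hle : (normalizedFactors g).count P ≤ n := by
      have h2 : P ^ ((normalizedFactors g).count P) ∣ g := (hc _).mpr le_rfl
      have h3 := natDegree_le_of_dvd h2 hg0
      rw [natDegree_pow, hd] at h3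
      have := hP.2.2.natDegree_pos
      nlinarith
    have : (Icc 1 n).filter (fun j => P ^ j ∣ g) = Icc 1 ((normalizedFactors g).count P) := by
      ext j
      simp only [mem_filter, mem_Icc, hc]
      omega
    rw [this, Nat.card_Icc]
    omega
  · intro P _ hP
    rw [Multiset.mem_toFinset] at hP
    rw [Multiset.count_eq_zero_of_notMem hP, zero_smul]

lemma sum_dvd {k : Type*} [Field k] [Finite k] [DecidableEq k] (ψ : AddChar k ℂ) (a : k) (n j : ℕ)
    (P : k[X]) (hP : P.Monic) :
    ∑ g ∈ mon k n, (by classical exact if P ^ j ∣ g then Lam ψ a g else 0) =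
      if j * P.natDegree ≤ n then Lam ψ a P ^ j * Sco ψ a (n - j * P.natDegree) else 0 := by
  classical
  have hPj := hP.pow j
  have hPd : (P ^ j).natDegree = j * P.natDegree := natDegree_pow P j
  rw [← Finset.sum_filter]
  split_ifs with hle
  · rw [Sco, Finset.mul_sum]
    symm
    refine Finset.sum_bij (fun h _ => P ^ j * h) ?_ ?_ ?_ ?_
    · intro h hh
      rw [mem_mon] at hh
      rw [mem_filter, mem_mon]
      refine ⟨⟨hPj.mul hh.1, ?_⟩, dvd_mul_right _ _⟩
      rw [hPj.natDegree_mul hh.1, hPd, hh.2]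
      omega
    · intro h _ h' _ e
      exact mul_left_cancel₀ hPj.ne_zero e
    · intro g hg
      rw [mem_filter, mem_mon] at hg
      obtain ⟨⟨g1, g2⟩, h, rfl⟩ := hg
      have hh : h.Monic := hPj.of_mul_monic_left g1
      refine ⟨h, ?_, rfl⟩
      rw [mem_mon]
      refine ⟨hh, ?_⟩
      rw [hPj.natDegree_mul hh, hPd] at g2
      omega
    · intro h hh
      rw [mem_mon] at hh
      rw [Lam_mul ψ a _ _ hPj hh.1, Lam_pow ψ a P hP]
  · apply Finset.sum_eq_zero
    intro g hg
    rw [mem_filter, mem_mon] at hg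
    exfalso
    apply hle
    rw [← hPd, ← hg.1.2]
    exact natDegree_le_of_dvd hg.2 hg.1.1.ne_zero

lemma newton {k : Type*} [Field k] [Finite k] [DecidableEq k] (ψ : AddChar k ℂ) (a : k) (n : ℕ) :
    (n : ℂ) * Sco ψ a n = ∑ m ∈ Icc 1 n, kap ψ a m * Sco ψ a (n - m) := by
  classical
  have h1 : (n : ℂ) * Sco ψ a n = ∑ P ∈ Irr k n, ∑ j ∈ Icc 1 n, (P.natDegree : ℂ) *
      (if j * P.natDegree ≤ n then Lam ψ a P ^ j * Sco ψ a (n - j * P.natDegree) else 0) := by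
    have : (n : ℂ) * Sco ψ a n = ∑ g ∈ mon k n, ∑ P ∈ Irr k n, ∑ j ∈ Icc 1 n,
        (P.natDegree : ℂ) * (if P ^ j ∣ g then Lam ψ a g else 0) := by
      rw [Sco, Finset.mul_sum]
      refine Finset.sum_congr rfl fun g hg => ?_
      conv_lhs => rw [deg_count n g hg]
      push_cast
      rw [Finset.sum_mul]
      refine Finset.sum_congr rfl fun P _ => ?_
      rw [Finset.sum_mul]
      refine Finset.sum_congr rfl fun j _ => ?_
      split_ifs <;> simp
    rw [this, Finset.sum_comm]
    refine Finset.sum_congr rfl fun P hP => ?_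
    rw [Finset.sum_comm]
    refine Finset.sum_congr rfl fun j _ => ?_
    rw [← Finset.mul_sum]
    rw [mem_Irr] at hP
    rw [← sum_dvd ψ a n j P hP.1]
  have h2 : ∑ m ∈ Icc 1 n, kap ψ a m * Sco ψ a (n - m) = ∑ P ∈ Irr k n, ∑ m ∈ Icc 1 n,
      if P.natDegree ∣ m then (P.natDegree : ℂ) * Lam ψ a P ^ (m / P.natDegree) * Sco ψ a (n - m)
        else 0 := by
    rw [Finset.sum_comm]
    refine Finset.sum_congr rfl fun m hm => ?_
    rw [mem_Icc] at hm
    rw [kap, Finset.sum_mul, ← Finset.sum_filter]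
    refine Finset.sum_congr ?_ fun _ _ => rfl
    ext P
    simp only [mem_filter, mem_Irr]
    constructor
    · rintro ⟨⟨x1, x2, x3⟩, x4⟩
      exact ⟨⟨x1, by omega, x3⟩, x4⟩
    · rintro ⟨⟨x1, x2, x3⟩, x4⟩
      exact ⟨⟨x1, Nat.le_of_dvd (by omega) x4, x3⟩, x4⟩
  rw [h1, h2]
  refine Finset.sum_congr rfl fun P hP => ?_
  rw [mem_Irr] at hP
  have hpos := hP.2.2.natDegree_pos
  simp only [mul_ite, mul_zero]
  rw [← Finset.sum_filter, ← Finset.sum_filter]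
  refine Finset.sum_bij (fun j _ => j * P.natDegree) ?_ ?_ ?_ ?_
  · intro j hj
    rw [mem_filter, mem_Icc] at hj ⊢
    refine ⟨⟨?_, hj.2⟩, dvd_mul_left _ _⟩
    exact Nat.mul_pos (by omega) hpos
  · intro j _ j' _ e
    exact Nat.eq_of_mul_eq_mul_right hpos e
  · intro m hm
    rw [mem_filter, mem_Icc] at hm
    obtain ⟨hm1, c, rfl⟩ := hm
    refine ⟨c, ?_, mul_comm _ _⟩
    rw [mem_filter, mem_Icc, mul_comm c]
    refine ⟨⟨?_, ?_⟩, hm1.2⟩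
    · by_contra h
      have : c = 0 := by omega
      subst this
      simp at hm1
    · nlinarith
  · intro j hj
    rw [Nat.mul_div_cancel _ hpos]
    ring

end lfun


section extsum
open Polynomial

lemma trace_minpoly {k K : Type*} [Field k] [Field K] [Algebra k K] [FiniteDimensional k K] (x : K) :
    Algebra.trace k K x =
      ((Module.finrank k K / (minpoly k x).natDegree : ℕ) : k) * -(minpoly k x).nextCoeff := by
  rw [trace_eq_finrank_mul_minpoly_nextCoeff]
  congr 2
  have hx : IsIntegral k x := Algebra.IsIntegral.isIntegral x
  have h1 := Module.finrank_mul_finrank k (IntermediateField.adjoin k {x}) K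
  rw [IntermediateField.adjoin.finrank hx] at h1
  rw [← h1, Nat.mul_div_cancel_left _ (minpoly.natDegree_pos hx)]

lemma reverse_facts {k K : Type*} [Field k] [Field K] [Algebra k K] [FiniteDimensional k K] (x : K)
    (hx0 : x ≠ 0) : ∃ R : k[X], R.Monic ∧ R.natDegree = (minpoly k x).natDegree ∧
      aeval x⁻¹ R = 0 ∧ R.nextCoeff = (minpoly k x).coeff 1 / (minpoly k x).coeff 0 := by
  have hx : IsIntegral k x := Algebra.IsIntegral.isIntegral x
  set f := minpoly k x with hf
  have h0 : f.coeff 0 ≠ 0 := minpoly.coeff_zero_ne_zero hx hx0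
  have hpos : 0 < f.natDegree := minpoly.natDegree_pos hx
  have htr : f.natTrailingDegree = 0 := natTrailingDegree_eq_zero.mpr (Or.inr h0)
  have hd : f.reverse.natDegree = f.natDegree := by rw [reverse_natDegree, htr, Nat.sub_zero]
  have hlc : f.reverse.leadingCoeff = f.coeff 0 := by
    rw [reverse_leadingCoeff, trailingCoeff, htr]
  have hRd : (C (f.coeff 0)⁻¹ * f.reverse).natDegree = f.natDegree := by
    rw [natDegree_C_mul (inv_ne_zero h0), hd]
  refine ⟨C (f.coeff 0)⁻¹ * f.reverse, ?_, hRd, ?_, ?_⟩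
  · rw [Monic, leadingCoeff_mul, leadingCoeff_C, hlc, inv_mul_cancel₀ h0]
  · rw [map_mul]
    have : aeval x⁻¹ f.reverse = 0 := by
      letI := invertibleOfNonzero hx0
      have h := (eval₂_reverse_eq_zero_iff (algebraMap k K) x f).mpr (minpoly.aeval k x)
      rw [invOf_eq_inv] at h
      exact h
    rw [this, mul_zero]
  · rw [nextCoeff_of_natDegree_pos (by omega), hRd, coeff_C_mul, coeff_reverse,
      revAt_le (by omega)]
    have : f.natDegree - (f.natDegree - 1) = 1 := by omega
    rw [this]
    field_simp

lemma trace_inv {k K : Type*} [Field k] [Field K] [Algebra k K] [FiniteDimensional k K] (x : K)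
    (hx0 : x ≠ 0) : Algebra.trace k K x⁻¹ =
      ((Module.finrank k K / (minpoly k x).natDegree : ℕ) : k) *
        -((minpoly k x).coeff 1 / (minpoly k x).coeff 0) := by
  obtain ⟨R, h1, h2, h3, h4⟩ := reverse_facts (k := k) x hx0
  obtain ⟨R', h1', h2', h3', h4'⟩ := reverse_facts (k := k) x⁻¹ (inv_ne_zero hx0)
  rw [inv_inv] at h3'
  have hd1 := minpoly.dvd k x⁻¹ h3
  have hd2 := minpoly.dvd k x h3'
  have l1 := natDegree_le_of_dvd hd1 h1.ne_zero
  have l2 := natDegree_le_of_dvd hd2 h1'.ne_zero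
  have hm : (minpoly k x⁻¹).Monic := minpoly.monic (Algebra.IsIntegral.isIntegral _)
  have e : R = minpoly k x⁻¹ := eq_of_monic_of_dvd_of_natDegree_le hm h1 hd1 (by omega)
  rw [trace_minpoly, ← e, h2, h4]

lemma addChar_nat_mul {k : Type*} [Field k] (ψ : AddChar k ℂ) (n : ℕ) (c : k) :
    ψ (n * c) = ψ c ^ n := by
  rw [← nsmul_eq_mul, AddChar.map_nsmul_eq_pow]

lemma ext_term {k K : Type*} [Field k] [DecidableEq k] [Field K] [DecidableEq K] [Algebra k K]
    [FiniteDimensional k K] (ψ : AddChar k ℂ) (a : k) (x : K) :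
    (if x = 0 then (0 : ℂ) else ψ (Algebra.trace k K (x + algebraMap k K a * x⁻¹))) =
      Lam ψ a (minpoly k x) ^ (Module.finrank k K / (minpoly k x).natDegree) := by
  have hx : IsIntegral k x := Algebra.IsIntegral.isIntegral x
  have hpos : 0 < Module.finrank k K / (minpoly k x).natDegree :=
    Nat.div_pos (Nat.le_of_dvd Module.finrank_pos (minpoly.degree_dvd hx)) (minpoly.natDegree_pos hx)
  split_ifs with h0
  · have : (minpoly k x).coeff 0 = 0 := by
      rw [h0, minpoly.zero]; simp
    rw [Lam, if_pos this, zero_pow hpos.ne']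
  · rw [Lam, if_neg (minpoly.coeff_zero_ne_zero hx h0), ← addChar_nat_mul]
    congr 1
    rw [map_add, ← Algebra.smul_def, map_smul, trace_minpoly, trace_inv x h0, smul_eq_mul]
    ring

lemma card_minpoly {k K : Type*} [Field k] [Finite k] [Field K] [Fintype K] [Algebra k K]
    (P : k[X]) (hP : Irreducible P) (hm : P.Monic) (hd : P.natDegree ∣ Module.finrank k K) :
    Nat.card {x : K // minpoly k x = P} = P.natDegree := by
  haveI := Fact.mk hP
  have hP0 := hP.ne_zero
  have hfr : Module.finrank k (AdjoinRoot P) = P.natDegree := by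
    rw [(AdjoinRoot.powerBasis hP0).finrank, AdjoinRoot.powerBasis_dim]
  have h1 := FiniteField.natCard_algHom_of_finrank_dvd (F := k) (K := AdjoinRoot P) (L := K)
    (by rw [hfr]; exact hd)
  rw [hfr] at h1
  rw [← h1, Nat.card_congr (AdjoinRoot.equiv K k P hP0)]
  apply Nat.card_congr
  refine Equiv.subtypeEquivRight fun x => ?_
  rw [mem_aroots]
  constructor
  · rintro rfl
    exact ⟨hP0, minpoly.aeval k x⟩
  · rintro ⟨_, h⟩
    exact (minpoly.eq_of_irreducible_of_monic hP h hm).symm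

lemma kap_eq {k K : Type*} [Field k] [Finite k] [DecidableEq k] [Field K] [Fintype K]
    [DecidableEq K] [Algebra k K] (ψ : AddChar k ℂ) (a : k) :
    ∑ x : K, (if x = 0 then (0 : ℂ) else ψ (Algebra.trace k K (x + algebraMap k K a * x⁻¹))) =
      kap ψ a (Module.finrank k K) := by
  classical
  rw [Finset.sum_congr rfl fun x _ => ext_term ψ a x, kap]
  rw [← Finset.sum_fiberwise_of_maps_to (g := fun x : K => minpoly k x)
    (t := (Irr k (Module.finrank k K)).filter (fun P => P.natDegree ∣ Module.finrank k K))]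
  · refine Finset.sum_congr rfl fun P hP => ?_
    rw [mem_filter, mem_Irr] at hP
    have : ∀ x ∈ univ.filter (fun x : K => minpoly k x = P),
        Lam ψ a (minpoly k x) ^ (Module.finrank k K / (minpoly k x).natDegree) =
        Lam ψ a P ^ (Module.finrank k K / P.natDegree) := by
      intro x hx
      rw [mem_filter] at hx
      rw [hx.2]
    rw [Finset.sum_congr rfl this, Finset.sum_const, nsmul_eq_mul]
    congr 2
    rw [← card_minpoly (K := K) P hP.1.2.2 hP.1.1 hP.2, Nat.card_eq_fintype_card,
      Fintype.card_subtype]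
  · intro x _
    have hx : IsIntegral k x := Algebra.IsIntegral.isIntegral x
    have hd := minpoly.degree_dvd hx
    rw [mem_filter, mem_Irr]
    exact ⟨⟨minpoly.monic hx, Nat.le_of_dvd Module.finrank_pos hd, minpoly.irreducible hx⟩, hd⟩

lemma kap_formula {k : Type*} [Field k] [Fintype k] [DecidableEq k] (ψ : AddChar k ℂ) (hψ : ψ ≠ 1)
    (a : k) (ha : a ≠ 0) (α β : ℂ) (h1 : α + β = - Sco ψ a 1) (h2 : α * β = Fintype.card k) (n : ℕ) :
    kap ψ a (n + 1) = - (α ^ (n + 1) + β ^ (n + 1)) := by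
  induction n using Nat.strong_induction_on with
  | _ n ih =>
  have hN := newton ψ a (n + 1)
  rcases n with _ | _ | n
  · simp [Sco_zero] at hN
    simp only [zero_add, pow_one]
    rw [← hN]
    linear_combination h1
  · have h0 := ih 0 (by omega)
    rw [show Icc 1 (0 + 1 + 1) = {1, 2} by decide, Finset.sum_pair (by norm_num)] at hN
    norm_num [Sco_zero, Sco_two ψ hψ a ha] at hN h0 ⊢
    rw [h0] at hN
    linear_combination (-1 : ℂ) * hN - 2 * h2 + (α + β) * h1
  · have e1 := ih n (by omega)
    have e2 := ih (n + 1) (by omega)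
    rw [Sco_big ψ hψ a _ (by omega), mul_zero, Finset.sum_Icc_succ_top (by omega),
      Finset.sum_Icc_succ_top (by omega), Finset.sum_Icc_succ_top (by omega)] at hN
    have hz : ∑ m ∈ Icc 1 n, kap ψ a m * Sco ψ a (n + 1 + 1 + 1 - m) = 0 := by
      apply Finset.sum_eq_zero
      intro m hm
      rw [mem_Icc] at hm
      rw [Sco_big ψ hψ a _ (by omega), mul_zero]
    rw [hz, show n + 1 + 1 + 1 - (n + 1) = 2 by omega, show n + 1 + 1 + 1 - (n + 1 + 1) = 1 by omega,
      show n + 1 + 1 + 1 - (n + 1 + 1 + 1) = 0 by omega, Sco_zero, Sco_two ψ hψ a ha, e1, e2] at hN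
    linear_combination (-1 : ℂ) * hN - (α ^ (n + 1) + β ^ (n + 1)) * h2 +
      (α ^ (n + 1 + 1) + β ^ (n + 1 + 1)) * h1

lemma kap_bound {k : Type*} [Field k] [Fintype k] [DecidableEq k] (hq : Odd (Fintype.card k))
    (ψ : AddChar k ℂ) (hψ : ψ ≠ 1) (a : k) (ha : a ≠ 0) (m : ℕ) (hm0 : 0 < m)
    (hm : (2 * Fintype.card k) * (2 * Fintype.card k + 3) ≤ Fintype.card k ^ m) :
    ‖kap ψ a (2 * m)‖ ≤ (6 * Fintype.card k + 7 : ℝ) * (Fintype.card k : ℝ) ^ m := by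
  classical
  obtain ⟨p, hpk, n, hp, hpn⟩ := FiniteField.card' k
  haveI := Fact.mk hp
  haveI : NeZero (2 * m) := ⟨by omega⟩
  let K := FiniteField.Extension k p (2 * m)
  haveI : Finite K := Module.finite_of_finite k
  letI : Fintype K := Fintype.ofFinite K
  have hfr : Module.finrank k K = 2 * m := FiniteField.finrank_extension k p (2 * m)
  have hc : Fintype.card K = Fintype.card k ^ (2 * m) := by
    rw [← Nat.card_eq_fintype_card, ← Nat.card_eq_fintype_card]
    exact FiniteField.natCard_extension k p (2 * m)
  have h := kl_ext_bound (K := K) hq m hc ψ hψ a ha hm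
  rw [kap_eq, hfr] at h
  exact h

lemma pow_growth (x y C q : ℝ) (hx : 0 ≤ x) (hy : 0 ≤ y) (hq : 1 < q) (hxy : x * y = q ^ 2)
    (m₀ : ℕ) (h : ∀ m ≥ m₀, x ^ m - y ^ m ≤ C * q ^ m) : x ≤ q := by
  by_contra hlt
  push Not at hlt
  have hy' : y ≤ q := by
    by_contra h'
    push Not at h'
    nlinarith
  have hq0 : 0 < q := by linarith
  have h1 : 1 < x / q := by rw [one_lt_div hq0]; exact hlt
  obtain ⟨N, hN⟩ := pow_unbounded_of_one_lt (C + 1) h1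
  have h2 := h (max m₀ N) (le_max_left _ _)
  have h3 : C + 1 < (x / q) ^ (max m₀ N) :=
    hN.trans_le (pow_le_pow_right₀ h1.le (le_max_right _ _))
  have h4 : y ^ (max m₀ N) ≤ q ^ (max m₀ N) := pow_le_pow_left₀ hy hy' _
  have h5 : 0 < q ^ (max m₀ N) := by positivity
  rw [div_pow, lt_div_iff₀ h5] at h3
  nlinarith

/-- Weil's bound for Kloosterman sums -/
theorem kloosterman_bound {k : Type*} [Field k] [Fintype k] [DecidableEq k]
    (hq : Odd (Fintype.card k)) (ψ : AddChar k ℂ) (hψ : ψ ≠ 1) (a : k) (ha : a ≠ 0) :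
    ‖∑ x : k, if x = 0 then (0 : ℂ) else ψ (x + a * x⁻¹)‖ ≤ 2 * Real.sqrt (Fintype.card k) := by
  rw [← Sco_one]
  set S := Sco ψ a 1 with hS
  set q := Fintype.card k with hqd
  have hq1 : 1 < q := Fintype.one_lt_card
  have hq1' : (1 : ℝ) < q := by exact_mod_cast hq1
  obtain ⟨w, hw⟩ := IsAlgClosed.exists_pow_nat_eq (S ^ 2 - 4 * q) (n := 2) (by norm_num)
  obtain ⟨α, hα⟩ : ∃ α, α = (-S + w) / 2 := ⟨_, rfl⟩
  obtain ⟨β, hβ⟩ : ∃ β, β = (-S - w) / 2 := ⟨_, rfl⟩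
  have hsum : α + β = -S := by rw [hα, hβ]; ring
  have hprod : α * β = q := by rw [hα, hβ]; linear_combination (-1 / 4 : ℂ) * hw
  have hf := kap_formula ψ hψ a ha α β hsum hprod
  obtain ⟨m₀, hm₀⟩ := pow_unbounded_of_one_lt (2 * q * (2 * q + 3)) hq1
  have hb : ∀ m ≥ max m₀ 1, ‖(α ^ 2) ^ m + (β ^ 2) ^ m‖ ≤ (6 * q + 7 : ℝ) * (q : ℝ) ^ m := by
    intro m hm
    have hm1 : 1 ≤ m := (le_max_right _ _).trans hm
    have hm2 : m₀ ≤ m := (le_max_left _ _).trans hm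
    have h1 := kap_bound hq ψ hψ a ha m (by omega)
      (hm₀.le.trans (Nat.pow_le_pow_right (by omega) hm2))
    have h2 := hf (2 * m - 1)
    rw [show 2 * m - 1 + 1 = 2 * m by omega] at h2
    rw [h2, norm_neg, pow_mul, pow_mul] at h1
    exact h1
  have hxy : (‖α‖ ^ 2) * (‖β‖ ^ 2) = (q : ℝ) ^ 2 := by
    rw [← mul_pow, ← norm_mul, hprod, Complex.norm_natCast]
  have hA : ‖α‖ ^ 2 ≤ q := by
    refine pow_growth (‖α‖ ^ 2) (‖β‖ ^ 2) (6 * q + 7) q (by positivity) (by positivity) hq1' hxy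
      (max m₀ 1) fun m hm => ?_
    have h1 := norm_sub_norm_le ((α ^ 2) ^ m) (-((β ^ 2) ^ m))
    rw [sub_neg_eq_add, norm_neg, norm_pow, norm_pow, norm_pow, norm_pow] at h1
    exact h1.trans (hb m hm)
  have hB : ‖β‖ ^ 2 ≤ q := by
    refine pow_growth (‖β‖ ^ 2) (‖α‖ ^ 2) (6 * q + 7) q (by positivity) (by positivity) hq1'
      (by rw [mul_comm]; exact hxy) (max m₀ 1) fun m hm => ?_
    have h1 := norm_sub_norm_le ((β ^ 2) ^ m) (-((α ^ 2) ^ m))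
    rw [sub_neg_eq_add, norm_neg, norm_pow, norm_pow, norm_pow, norm_pow, add_comm] at h1
    exact h1.trans (hb m hm)
  have hA' : ‖α‖ ≤ Real.sqrt q := Real.le_sqrt_of_sq_le hA
  have hB' : ‖β‖ ≤ Real.sqrt q := Real.le_sqrt_of_sq_le hB
  have : ‖S‖ ≤ ‖α‖ + ‖β‖ := by
    rw [← norm_neg, ← hsum]
    exact norm_add_le _ _
  linarith

end extsum

section graphpart

lemma gs_sq {F : Type} [Field F] [Fintype F] [DecidableEq F] (hF : ringChar F ≠ 2)
    (ψ : AddChar F ℂ) (hψ : ψ ≠ 1) (c : F) (hc : c ≠ 0) :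
    (∑ x : F, ψ (c * x ^ 2)) ^ 2 = ((quadraticChar F (-1) : ℤ) : ℂ) * Fintype.card F := by
  have hprim := AddChar.IsPrimitive.of_ne_one hψ
  have hψc : ψ.mulShift c ≠ 1 := hprim hc
  set χ : MulChar F ℂ := (quadraticChar F).ringHomComp (Int.castRingHom ℂ) with hχ
  have hχ1 : χ ≠ 1 := by
    obtain ⟨a, ha⟩ := quadraticChar_exists_neg_one' hF
    intro h
    have h2 : χ a = 1 := by rw [h]; exact MulChar.one_apply_coe a
    rw [hχ, MulChar.ringHomComp_apply, ha] at h2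
    norm_num at h2
  have hχ2 : χ.IsQuadratic := (quadraticChar_isQuadratic F).comp _
  have h := gaussSum_sq hχ1 hχ2 (AddChar.IsPrimitive.of_ne_one hψc)
  have e : ∑ x : F, ψ (c * x ^ 2) = gaussSum χ (ψ.mulShift c) := by
    rw [← Finset.sum_fiberwise (s := Finset.univ) (g := fun x : F => x ^ 2)]
    have h1 : ∀ z : F, ∑ x ∈ Finset.univ.filter (fun x : F => x ^ 2 = z), ψ (c * x ^ 2)
        = (χ z + 1) * ψ.mulShift c z := by
      intro z
      rw [Finset.sum_congr rfl (g := fun _ => ψ (c * z))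
        (fun x hx => by rw [(Finset.mem_filter.1 hx).2])]
      rw [Finset.sum_const, nsmul_eq_mul, AddChar.mulShift_apply]
      congr 1
      have := quadraticChar_card_sqrts hF z
      have h3 : ({x : F | x ^ 2 = z} : Set F).toFinset = Finset.univ.filter (fun x : F => x ^ 2 = z) := by
        ext; simp
      rw [h3] at this
      have h4 := congrArg (Int.cast : ℤ → ℂ) this
      push_cast at h4
      rw [h4]; rfl
    rw [Finset.sum_congr rfl (fun z _ => h1 z)]
    simp only [add_mul, one_mul, Finset.sum_add_distrib]
    rw [AddChar.sum_eq_zero_of_ne_one hψc, add_zero]; rfl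
  rw [e, h]; rfl

lemma gs_one {F : Type} [Field F] [Fintype F] [DecidableEq F]
    (ψ : AddChar F ℂ) (s : F) (h4 : (4 : F) ≠ 0) (hs : s ≠ 0) (w : F) :
    ∑ x : F, ψ (-(x ^ 2) / (4 * s) + x * w) = ψ (s * w ^ 2) * ∑ x : F, ψ (-1 / (4 * s) * x ^ 2) := by
  rw [← Equiv.sum_comp (Equiv.addRight (2 * s * w)), Finset.mul_sum]
  apply Finset.sum_congr rfl
  intro x _
  rw [← AddChar.map_add_eq_mul]
  congr 1
  simp only [Equiv.coe_addRight]
  field_simp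
  ring

lemma gs_two {F : Type} [Field F] [Fintype F] [DecidableEq F] (hF : ringChar F ≠ 2)
    (ψ : AddChar F ℂ) (hψ : ψ ≠ 1) (s : F) (h4 : (4 : F) ≠ 0) (hs : s ≠ 0) (w : F × F) :
    ∑ ξ : F × F, ψ (-nrm ξ / (4 * s)) * ψ (ξ.1 * w.1 + ξ.2 * w.2)
      = ((quadraticChar F (-1) : ℤ) : ℂ) * Fintype.card F * ψ (s * nrm w) := by
  have hc : -1 / (4 * s) ≠ 0 := div_ne_zero (by simp) (mul_ne_zero h4 hs)
  rw [← gs_sq hF ψ hψ _ hc]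
  have h1 := gs_one ψ s h4 hs w.1
  have h2 := gs_one ψ s h4 hs w.2
  have e : ψ (s * nrm w) = ψ (s * w.1 ^ 2) * ψ (s * w.2 ^ 2) := by
    rw [← AddChar.map_add_eq_mul]; congr 1; unfold nrm; ring
  rw [e]
  have h3 : ∑ ξ : F × F, ψ (-nrm ξ / (4 * s)) * ψ (ξ.1 * w.1 + ξ.2 * w.2)
      = (∑ x : F, ψ (-(x ^ 2) / (4 * s) + x * w.1)) * ∑ x : F, ψ (-(x ^ 2) / (4 * s) + x * w.2) := by
    rw [Fintype.sum_prod_type, Finset.sum_mul_sum]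
    refine Finset.sum_congr rfl fun x _ => Finset.sum_congr rfl fun y _ => ?_
    rw [← AddChar.map_add_eq_mul, ← AddChar.map_add_eq_mul]
    congr 1; simp only [nrm]; ring
  rw [h3, h1, h2]; ring

/-- The Kloosterman type coefficient. -/
noncomputable def Kco {F : Type} [Field F] [Fintype F] [DecidableEq F]
    (ψ : AddChar F ℂ) (t : F) (ξ : F × F) : ℂ :=
  ∑ s : F, if s = 0 then (0 : ℂ) else ψ (-(s * t) + -nrm ξ / (4 * s))

lemma Kco_bound {F : Type} [Field F] [Fintype F] [DecidableEq F] (hq : Odd (Fintype.card F))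
    (ψ : AddChar F ℂ) (hψ : ψ ≠ 1) (t : F) (ht : t ≠ 0) (h4 : (4 : F) ≠ 0) (ξ : F × F) :
    ‖Kco ψ t ξ‖ ≤ 2 * Real.sqrt (Fintype.card F) := by
  have hnt : -t ≠ 0 := neg_ne_zero.2 ht
  have e : Kco ψ t ξ = ∑ x : F, if x = 0 then (0 : ℂ) else ψ (x + (t * nrm ξ / 4) * x⁻¹) := by
    rw [← Equiv.sum_comp (Equiv.mulRight₀ (-t) hnt)]
    unfold Kco
    apply Finset.sum_congr rfl
    intro s _
    by_cases hs : s = 0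
    · simp [hs]
    · have : s * -t ≠ 0 := mul_ne_zero hs hnt
      have hc : Equiv.mulRight₀ (-t) hnt s = s * -t := rfl
      rw [hc, if_neg hs, if_neg this]
      congr 1
      field_simp
      try ring
  by_cases hn : nrm ξ = 0
  · have h1 : Kco ψ t ξ = -1 := by
      rw [e, hn]
      have := AddChar.sum_eq_zero_of_ne_one hψ
      rw [← Finset.add_sum_erase _ _ (Finset.mem_univ 0), AddChar.map_zero_eq_one] at this
      rw [← Finset.add_sum_erase _ _ (Finset.mem_univ 0), if_pos rfl, zero_add]
      rw [← eq_neg_iff_add_eq_zero.2 (by rw [add_comm]; exact this)]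
      apply Finset.sum_congr rfl
      intro x hx
      rw [if_neg (Finset.ne_of_mem_erase hx)]
      simp
    rw [h1, norm_neg, norm_one]
    have : (1 : ℝ) ≤ Real.sqrt (Fintype.card F) := by
      rw [Real.one_le_sqrt]
      exact_mod_cast Fintype.card_pos
    linarith
  · rw [e]
    exact kloosterman_bound hq ψ hψ _ (div_ne_zero (mul_ne_zero ht hn) h4)

lemma pointwise_exp {F : Type} [Field F] [Fintype F] [DecidableEq F] (hF : ringChar F ≠ 2)
    (ψ : AddChar F ℂ) (hψ : ψ ≠ 1) (t : F) (h4 : (4 : F) ≠ 0) (w : F × F) :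
    ((quadraticChar F (-1) : ℤ) : ℂ) * Fintype.card F *
      ((Fintype.card F : ℂ) * (if nrm w = t then 1 else 0) - 1)
      = ∑ ξ : F × F, Kco ψ t ξ * ψ (ξ.1 * w.1 + ξ.2 * w.2) := by
  have h := AddChar.sum_mulShift (nrm w - t) (AddChar.IsPrimitive.of_ne_one hψ)
  have h1 : ((Fintype.card F : ℂ) * (if nrm w = t then 1 else 0) - 1)
      = ∑ s : F, if s = 0 then (0 : ℂ) else ψ (s * (nrm w - t)) := by
    have h2 : (Fintype.card F : ℂ) * (if nrm w = t then 1 else 0) = ∑ s : F, ψ (s * (nrm w - t)) := by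
      rw [h]
      simp only [sub_eq_zero]
      split_ifs <;> simp
    rw [h2, ← Finset.add_sum_erase _ _ (Finset.mem_univ 0),
      ← Finset.add_sum_erase (Finset.univ) (fun s => if s = 0 then (0 : ℂ) else _) (Finset.mem_univ 0),
      if_pos rfl, zero_mul, AddChar.map_zero_eq_one, zero_add, add_sub_cancel_left]
    apply Finset.sum_congr rfl
    intro x hx
    rw [if_neg (Finset.ne_of_mem_erase hx)]
  rw [h1, Finset.mul_sum]
  unfold Kco
  simp only [Finset.sum_mul]
  rw [Finset.sum_comm]
  apply Finset.sum_congr rfl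
  intro s _
  by_cases hs : s = 0
  · simp [hs]
  simp only [if_neg hs]
  have e : ψ (s * (nrm w - t)) = ψ (-(s * t)) * ψ (s * nrm w) := by
    rw [← AddChar.map_add_eq_mul]; congr 1; ring
  rw [e, mul_left_comm, ← gs_two hF ψ hψ s h4 hs w, Finset.mul_sum]
  apply Finset.sum_congr rfl
  intro ξ _
  rw [AddChar.map_add_eq_mul ψ (-(s * t))]; ring

/-- Fourier transform of the indicator of a finite set. -/
noncomputable def hatF {F : Type} [Field F] (ψ : AddChar F ℂ) (B : Finset (F × F)) (ξ : F × F) : ℂ :=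
  ∑ u ∈ B, ψ (ξ.1 * u.1 + ξ.2 * u.2)

lemma hat_mul {F : Type} [Field F] [Fintype F] (ψ : AddChar F ℂ) (B E : Finset (F × F)) (ξ : F × F) :
    hatF ψ B ξ * (starRingEnd ℂ) (hatF ψ E ξ)
      = ∑ u ∈ B, ∑ v ∈ E, ψ (ξ.1 * (u - v).1 + ξ.2 * (u - v).2) := by
  unfold hatF
  rw [map_sum, Finset.sum_mul_sum]
  refine Finset.sum_congr rfl fun u _ => Finset.sum_congr rfl fun v _ => ?_
  rw [← AddChar.map_neg_eq_conj, ← AddChar.map_add_eq_mul]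
  congr 1
  simp only [Prod.fst_sub, Prod.snd_sub]
  ring

lemma planch {F : Type} [Field F] [Fintype F] [DecidableEq F]
    (ψ : AddChar F ℂ) (hψ : ψ ≠ 1) (B : Finset (F × F)) :
    ∑ ξ : F × F, ‖hatF ψ B ξ‖ ^ 2 = (Fintype.card F : ℝ) ^ 2 * B.card := by
  have hp := AddChar.IsPrimitive.of_ne_one hψ
  have h : ((∑ ξ : F × F, ‖hatF ψ B ξ‖ ^ 2 : ℝ) : ℂ) = (Fintype.card F : ℂ) ^ 2 * B.card := by
    push_cast
    simp only [← Complex.mul_conj', hat_mul]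
    rw [Finset.sum_comm]
    have h1 : ∀ u ∈ B, ∑ ξ : F × F, ∑ v ∈ B, ψ (ξ.1 * (u - v).1 + ξ.2 * (u - v).2)
        = (Fintype.card F : ℂ) ^ 2 := by
      intro u hu
      rw [Finset.sum_comm]
      have h2 : ∀ v ∈ B, ∑ ξ : F × F, ψ (ξ.1 * (u - v).1 + ξ.2 * (u - v).2)
          = if u = v then (Fintype.card F : ℂ) ^ 2 else 0 := by
        intro v _
        simp only [AddChar.map_add_eq_mul]
        rw [Fintype.sum_prod_type]
        simp only [← Finset.mul_sum, ← Finset.sum_mul]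
        rw [AddChar.sum_mulShift _ hp, AddChar.sum_mulShift _ hp]
        simp only [Prod.fst_sub, Prod.snd_sub, sub_eq_zero, Prod.ext_iff]
        by_cases h1 : u.1 = v.1 <;> by_cases h2 : u.2 = v.2 <;> simp [h1, h2, sq]
      rw [Finset.sum_congr rfl h2, Finset.sum_ite_eq, if_pos hu]
    rw [Finset.sum_congr rfl h1, Finset.sum_const, nsmul_eq_mul, mul_comm]
  exact_mod_cast h

lemma mixing {F : Type} [Field F] [Fintype F] [DecidableEq F] (hq : Odd (Fintype.card F))
    (t : F) (ht : t ≠ 0) (B E : Finset (F × F)) :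
    ‖(Fintype.card F : ℝ) * (∑ u ∈ B, ((E.filter (fun v => nrm (u - v) = t)).card : ℝ))
      - B.card * E.card‖ ≤ 2 * Real.sqrt (Fintype.card F) * (Fintype.card F) *
        (Real.sqrt B.card * Real.sqrt E.card) := by
  have hF : ringChar F ≠ 2 := by
    intro h
    have := FiniteField.even_card_of_char_two h
    rw [Nat.odd_iff] at hq
    omega
  have h2 : (2 : F) ≠ 0 := Ring.two_ne_zero hF
  have h4 : (4 : F) ≠ 0 := by
    have : (4 : F) = 2 * 2 := by norm_num
    rw [this]; exact mul_ne_zero h2 h2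
  obtain ⟨ψ, hψ1⟩ := (AddChar.exists_apply_ne_zero (a := (1 : F))).2 one_ne_zero
  have hψ : ψ ≠ 1 := by
    rintro rfl; simp at hψ1
  have hq0 : (0 : ℝ) < Fintype.card F := by exact_mod_cast Fintype.card_pos
  set q : ℝ := (Fintype.card F : ℝ) with hqdef
  set e : ℝ := ∑ u ∈ B, ((E.filter (fun v => nrm (u - v) = t)).card : ℝ) with he
  have hid : ((quadraticChar F (-1) : ℤ) : ℂ) * Fintype.card F * ((q * e - B.card * E.card : ℝ) : ℂ)
      = ∑ ξ : F × F, Kco ψ t ξ * (hatF ψ B ξ * (starRingEnd ℂ) (hatF ψ E ξ)) := by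
    simp only [hat_mul, Finset.mul_sum]
    rw [Finset.sum_comm]
    have h1 : ∀ u ∈ B, ∑ ξ : F × F, ∑ v ∈ E, Kco ψ t ξ * ψ (ξ.1 * (u - v).1 + ξ.2 * (u - v).2)
        = ((quadraticChar F (-1) : ℤ) : ℂ) * Fintype.card F *
          ((Fintype.card F : ℂ) * ((E.filter (fun v => nrm (u - v) = t)).card : ℂ) - E.card) := by
      intro u _
      rw [Finset.sum_comm]
      simp only [← pointwise_exp hF ψ hψ t h4]
      rw [← Finset.mul_sum, Finset.sum_sub_distrib, ← Finset.mul_sum, Finset.sum_boole]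
      simp
    rw [Finset.sum_congr rfl h1, ← Finset.mul_sum, Finset.sum_sub_distrib, ← Finset.mul_sum]
    simp [hqdef, he]
  have hnorm := congrArg norm hid
  have hε : ‖((quadraticChar F (-1) : ℤ) : ℂ)‖ = 1 := by
    rcases quadraticChar_dichotomy (F := F) (a := -1) (by simp) with h | h <;> rw [h] <;> simp
  rw [norm_mul, norm_mul, hε, one_mul, Complex.norm_natCast, Complex.norm_real] at hnorm
  have hCS : ∑ ξ : F × F, ‖hatF ψ B ξ‖ * ‖hatF ψ E ξ‖ ≤ q ^ 2 * (Real.sqrt B.card * Real.sqrt E.card) := by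
    have := Real.sum_mul_le_sqrt_mul_sqrt Finset.univ (fun ξ => ‖hatF ψ B ξ‖) (fun ξ => ‖hatF ψ E ξ‖)
    rw [planch ψ hψ, planch ψ hψ, Real.sqrt_mul (by positivity), Real.sqrt_mul (by positivity),
      Real.sqrt_sq hq0.le] at this
    calc _ ≤ _ := this
      _ = _ := by ring
  have hle : q * ‖q * e - B.card * E.card‖
      ≤ 2 * Real.sqrt q * (q ^ 2 * (Real.sqrt B.card * Real.sqrt E.card)) := by
    rw [hnorm]
    calc _ ≤ ∑ ξ : F × F, ‖Kco ψ t ξ * (hatF ψ B ξ * (starRingEnd ℂ) (hatF ψ E ξ))‖ := norm_sum_le _ _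
      _ ≤ ∑ ξ : F × F, 2 * Real.sqrt q * (‖hatF ψ B ξ‖ * ‖hatF ψ E ξ‖) := by
        apply Finset.sum_le_sum
        intro ξ _
        rw [norm_mul, norm_mul, RCLike.norm_conj]
        exact mul_le_mul_of_nonneg_right (Kco_bound hq ψ hψ t ht h4 ξ) (by positivity)
      _ ≤ _ := by
        rw [← Finset.mul_sum]
        exact mul_le_mul_of_nonneg_left hCS (by positivity)
  refine le_of_mul_le_mul_left (hle.trans (le_of_eq ?_)) hq0
  ring

end graphpart

theorem low_degree_vertices_are_few
    {F : Type} [Field F] [Fintype F] [DecidableEq F]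
    (hq : Odd (Fintype.card F)) (t : F) (ht : t ≠ 0)
    (E : Finset (F × F)) (hE : E.Nonempty) :
    ((E \ E.filter (fun u =>
        (E.card : ℝ) / (2 * (Fintype.card F : ℝ)) ≤
          ((E.filter (fun v => nrm (u - v) = t)).card : ℝ))).card : ℝ) ≤
      16 * (Fintype.card F : ℝ) ^ 3 / (E.card : ℝ) := by
  have hE0 : (0 : ℝ) < E.card := by exact_mod_cast hE.card_pos
  have hq0 : (0 : ℝ) < Fintype.card F := by exact_mod_cast Fintype.card_pos
  set B := E \ E.filter (fun u =>
        (E.card : ℝ) / (2 * (Fintype.card F : ℝ)) ≤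
          ((E.filter (fun v => nrm (u - v) = t)).card : ℝ) ) with hB
  have hm := mixing hq t ht B E
  have hdeg : ∑ u ∈ B, ((E.filter (fun v => nrm (u - v) = t)).card : ℝ)
      ≤ B.card * ((E.card : ℝ) / (2 * (Fintype.card F : ℝ))) := by
    rw [← nsmul_eq_mul]
    apply Finset.sum_le_card_nsmul
    intro u hu
    rw [hB, Finset.mem_sdiff, Finset.mem_filter] at hu
    by_contra hc
    exact hu.2 ⟨hu.1, (not_le.1 hc).le⟩
  rw [le_div_iff₀ hE0]
  generalize (∑ u ∈ B, ((E.filter (fun v => nrm (u - v) = t)).card : ℝ)) = e at hm hdeg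
  have hb0 : (0 : ℝ) ≤ B.card := Nat.cast_nonneg _
  generalize (B.card : ℝ) = b at *
  generalize (E.card : ℝ) = n at *
  generalize (Fintype.card F : ℝ) = q at *
  have h1 : q * e ≤ b * n / 2 := by
    calc q * e ≤ q * (b * (n / (2 * q))) := mul_le_mul_of_nonneg_left hdeg hq0.le
      _ = b * n / 2 := by field_simp
  have h2 : b * n / 2 ≤ 2 * Real.sqrt q * q * (Real.sqrt b * Real.sqrt n) := by
    rw [Real.norm_eq_abs] at hm
    have := neg_abs_le (q * e - b * n)
    linarith
  have h3 : (b * n / 2) ^ 2 ≤ (2 * Real.sqrt q * q * (Real.sqrt b * Real.sqrt n)) ^ 2 :=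
    pow_le_pow_left₀ (by positivity) h2 2
  have h4 : (2 * Real.sqrt q * q * (Real.sqrt b * Real.sqrt n)) ^ 2 = 4 * q ^ 3 * (b * n) := by
    rw [mul_pow, mul_pow, mul_pow, mul_pow, Real.sq_sqrt hq0.le, Real.sq_sqrt hb0, Real.sq_sqrt hE0.le]
    ring
  rw [h4] at h3
  rcases hb0.eq_or_lt with h | h
  · rw [← h, zero_mul]; positivity
  · have hbn : 0 < b * n := mul_pos h hE0
    refine le_of_mul_le_mul_right ?_ hbn
    nlinarith
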